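/- Let k ≥ 2, let u(x,t) = u_0(x − t) with u_0 : ℝ → ℝ of class C^{k+4}, let u_h be a DG solution on [0,T] (with either the periodic upwind flux, u_0 being 2π-periodic, or the Dirichlet inflow flux), and suppose the initial error satisfies ‖u_h(·,0) − u_I^2(·,0)‖_0 ≤ C₀ h^{k+3} M_{k+4}. Then there is a constant C depending only on k, C₀ and the quasi-uniformity constant c such that for every cell τ_j, every t ∈ [0,T], and every interior left Radau point r of τ_j (i.e. r ∈ (x_{j-1/2}, x_{j+1/2}) with L_{j,k+1}(r) + L_{j,k}(r) = 0), |∂_x u(r,t) − ∂_x u_h(r,t)| ≤ C (1+t) h^{k+1} M_{k+4}, where ∂_x u_h(·,t) denotes the derivative of the polynomial piece of u_h on τ_j. -/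

import Mathlib

open MeasureTheory intervalIntegral

/-- Legendre polynomial of degree `m` via the Rodrigues formula. -/
noncomputable def legendreP (m : ℕ) : ℝ → ℝ :=
  fun s => (1 / ((2:ℝ) ^ m * (Nat.factorial m : ℝ))) *
    iteratedDeriv m (fun t : ℝ => (t ^ 2 - 1) ^ m) s

/-- Legendre polynomial rescaled to the cell `(a, b)`. -/
noncomputable def legendreCell (m : ℕ) (a b : ℝ) : ℝ → ℝ :=
  fun x => legendreP m ((2 * x - (a + b)) / (b - a))

/-- `P` is the Gauss–Radau projection (onto polynomials of degree ≤ k on `(a,b)`) of `u`. -/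
def IsGRProj (k : ℕ) (a b : ℝ) (u : ℝ → ℝ) (P : Polynomial ℝ) : Prop :=
  P.natDegree ≤ k ∧
  (∀ v : Polynomial ℝ, v.natDegree + 1 ≤ k →
    (∫ x in a..b, P.eval x * v.eval x) = ∫ x in a..b, u x * v.eval x) ∧
  P.eval b = u b

/-- The scaled primitive `(D⁻¹ v)(x) = (2/(b-a)) ∫_a^x v`. -/
noncomputable def Dinv (a b : ℝ) (v : ℝ → ℝ) : ℝ → ℝ :=
  fun x => (2 / (b - a)) * ∫ t in a..x, v t

/-- `F` is the sequence of correction polynomials on the cell `(a,b)`: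
`F 1 = P_h^-(D⁻¹ L_k)` and `F i = -P_h^-(D⁻¹ F (i-1))` for `i ≥ 2`. -/
def IsFSeq (k : ℕ) (a b : ℝ) (F : ℕ → Polynomial ℝ) : Prop :=
  IsGRProj k a b (Dinv a b (legendreCell k a b)) (F 1) ∧
  ∀ i, 2 ≤ i → IsGRProj k a b (Dinv a b (fun x => (F (i-1)).eval x)) (-(F i))

/-- The `m`-th Radau coefficient of `w` on the cell `(a,b)`. -/
noncomputable def radauCoeff (a b : ℝ) (w : ℝ → ℝ) (m : ℕ) : ℝ :=
  w b - (1 / (b - a)) *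
    ∫ x in a..b, w x * ∑ l ∈ Finset.range m, (2 * (l:ℝ) + 1) * legendreCell l a b x

/-- `G_i(t) = (d/dt)^i u_{j,k+1}(t)` for `u(x,t) = u0(x - t)` on the cell `(a,b)`. -/
noncomputable def Gfun (k : ℕ) (a b : ℝ) (u0 : ℝ → ℝ) (i : ℕ) (t : ℝ) : ℝ :=
  iteratedDeriv i (fun s => radauCoeff a b (fun y => u0 (y - s)) (k + 1)) t

/-- `w_i(x,t) = (h_j/2)^i G_i(t) F_i(x)` on the cell `(a,b)`. -/
noncomputable def wFun (k : ℕ) (a b : ℝ) (u0 : ℝ → ℝ) (F : ℕ → Polynomial ℝ)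
    (i : ℕ) (y t : ℝ) : ℝ :=
  ((b - a) / 2) ^ i * Gfun k a b u0 i t * (F i).eval y

/-- `w^l = Σ_{i=1}^l w_i` on the cell `(a,b)`. -/
noncomputable def wSum (k : ℕ) (a b : ℝ) (u0 : ℝ → ℝ) (F : ℕ → Polynomial ℝ)
    (l : ℕ) (y t : ℝ) : ℝ :=
  ∑ i ∈ Finset.Icc 1 l, wFun k a b u0 F i y t

/-- The interpolation function `u_I^l = P_h^- u - w^l` on the cell `(a,b)`;
here `P t` is the Gauss–Radau projection of `u(·,t)`. -/
noncomputable def uIl (k : ℕ) (a b : ℝ) (u0 : ℝ → ℝ) (P : ℝ → Polynomial ℝ)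
    (F : ℕ → Polynomial ℝ) (l : ℕ) (y t : ℝ) : ℝ :=
  (P t).eval y - wSum k a b u0 F l y t

/-- `uh` is a DG solution on `[0,T]` on the mesh `x 0 < x 1 < … < x N`
(the piece on the cell `τ_j = (x (j-1), x j)` is the polynomial `uh j t`),
with prescribed inflow value `inflow t` at the left boundary. -/
def IsDGSol (k N : ℕ) (x : ℕ → ℝ) (T : ℝ) (inflow : ℝ → ℝ)
    (uh : ℕ → ℝ → Polynomial ℝ) : Prop :=
  (∀ j ∈ Finset.Icc 1 N, ∀ t : ℝ, (uh j t).natDegree ≤ k) ∧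
  (∀ j ∈ Finset.Icc 1 N, ∀ y : ℝ, ContDiff ℝ 1 (fun t => (uh j t).eval y)) ∧
  (∀ j ∈ Finset.Icc 1 N, ∀ t ∈ Set.Icc (0:ℝ) T, ∀ v : Polynomial ℝ, v.natDegree ≤ k →
    (∫ y in (x (j-1))..(x j), deriv (fun s => (uh j s).eval y) t * v.eval y)
      - (∫ y in (x (j-1))..(x j), (uh j t).eval y * v.derivative.eval y)
      + (uh j t).eval (x j) * v.eval (x j)
      - (if j = 1 then inflow t else (uh (j-1) t).eval (x (j-1))) * v.eval (x (j-1)) = 0)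

/-- The error `u - u_I^l` on the cell `τ_j`, as a function of `(y, s)`. -/
noncomputable def errFun (k l : ℕ) (x : ℕ → ℝ) (u0 : ℝ → ℝ)
    (P : ℕ → ℝ → Polynomial ℝ) (F : ℕ → ℕ → Polynomial ℝ) (j : ℕ) (y s : ℝ) : ℝ :=
  u0 (y - s) - uIl k (x (j-1)) (x j) u0 (P j) (F j) l y s

open Polynomial in
/-- Legendre polynomial as a polynomial. -/
noncomputable def legPoly (m : ℕ) : Polynomial ℝ :=
  C (1 / ((2:ℝ) ^ m * (Nat.factorial m : ℝ))) * derivative^[m] ((X ^ 2 - 1) ^ m)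

theorem polyEval_deriv (p : Polynomial ℝ) : deriv (fun s => p.eval s) = fun s => p.derivative.eval s := by
  funext s
  exact p.deriv

theorem polyEval_iteratedDeriv (p : Polynomial ℝ) (m : ℕ) :
    iteratedDeriv m (fun s => p.eval s) = fun s => (Polynomial.derivative^[m] p).eval s := by
  induction m with
  | zero => simp
  | succ n ih => rw [iteratedDeriv_succ, ih, polyEval_deriv, Function.iterate_succ_apply']

theorem legendreP_eq (m : ℕ) (s : ℝ) : legendreP m s = (legPoly m).eval s := by
  have h := polyEval_iteratedDeriv ((Polynomial.X ^ 2 - 1) ^ m) m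
  simp only [Polynomial.eval_pow, Polynomial.eval_sub, Polynomial.eval_X, Polynomial.eval_one] at h
  unfold legendreP legPoly
  rw [h, Polynomial.eval_mul, Polynomial.eval_C]

theorem legPoly_natDegree (m : ℕ) : (legPoly m).natDegree ≤ m := by
  unfold legPoly
  refine (Polynomial.natDegree_C_mul_le _ _).trans ?_
  refine (Polynomial.natDegree_iterate_derivative _ _).trans ?_
  have : ((Polynomial.X ^ 2 - 1 : Polynomial ℝ) ^ m).natDegree ≤ m * 2 := by
    refine Polynomial.natDegree_pow_le_of_le m ?_
    compute_degree
  omega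

theorem rod_fact (m : ℕ) : ((Polynomial.X ^ 2 - 1 : Polynomial ℝ) ^ m)
    = (Polynomial.X - Polynomial.C 1) ^ m * (Polynomial.X + 1) ^ m := by
  rw [← mul_pow]; congr 1; simp; ring

theorem rod_fact' (m : ℕ) : ((Polynomial.X ^ 2 - 1 : Polynomial ℝ) ^ m)
    = (Polynomial.X - Polynomial.C (-1)) ^ m * (Polynomial.X - 1) ^ m := by
  rw [← mul_pow]; congr 1; simp; ring

theorem legPoly_eval_one (m : ℕ) : (legPoly m).eval 1 = 1 := by
  have := Polynomial.aeval_iterate_derivative_self ((Polynomial.X ^ 2 - 1 : Polynomial ℝ) ^ m) m (1:ℝ)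
    (p' := (Polynomial.X + 1) ^ m) (by rw [Algebra.algebraMap_self, Polynomial.map_id, rod_fact])
  rw [Polynomial.coe_aeval_eq_eval] at this
  unfold legPoly
  rw [Polynomial.eval_mul, this]
  have h2 : (Nat.factorial m : ℝ) ≠ 0 := by positivity
  simp
  rw [show (1:ℝ) + 1 = 2 by norm_num]
  field_simp

theorem legPoly_eval_neg_one (m : ℕ) : (legPoly m).eval (-1) = (-1) ^ m := by
  have := Polynomial.aeval_iterate_derivative_self ((Polynomial.X ^ 2 - 1 : Polynomial ℝ) ^ m) m (-1:ℝ)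
    (p' := (Polynomial.X - 1) ^ m) (by rw [Algebra.algebraMap_self, Polynomial.map_id, rod_fact'])
  rw [Polynomial.coe_aeval_eq_eval] at this
  unfold legPoly
  rw [Polynomial.eval_mul, this]
  have h2 : (Nat.factorial m : ℝ) ≠ 0 := by positivity
  simp
  rw [show (-1:ℝ) - 1 = (-1) * 2 by norm_num, mul_pow]
  field_simp

theorem rod_vanish (m n : ℕ) (h : n < m) :
    (Polynomial.derivative^[n] ((Polynomial.X ^ 2 - 1 : Polynomial ℝ) ^ m)).eval 1 = 0 ∧
    (Polynomial.derivative^[n] ((Polynomial.X ^ 2 - 1 : Polynomial ℝ) ^ m)).eval (-1) = 0 := by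
  have h1 := Polynomial.aeval_iterate_derivative_of_lt ((Polynomial.X ^ 2 - 1 : Polynomial ℝ) ^ m) m (1:ℝ)
    (p' := (Polynomial.X + 1) ^ m) (by rw [Algebra.algebraMap_self, Polynomial.map_id, rod_fact]) h
  have h2 := Polynomial.aeval_iterate_derivative_of_lt ((Polynomial.X ^ 2 - 1 : Polynomial ℝ) ^ m) m (-1:ℝ)
    (p' := (Polynomial.X - 1) ^ m) (by rw [Algebra.algebraMap_self, Polynomial.map_id, rod_fact']) h
  rw [Polynomial.coe_aeval_eq_eval] at h1 h2
  exact ⟨h1, h2⟩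

theorem poly_ii (p : Polynomial ℝ) (a b : ℝ) : IntervalIntegrable (fun x => p.eval x) volume a b :=
  (p.continuous).intervalIntegrable _ _

theorem poly_ibp (p q : Polynomial ℝ) (a b : ℝ) :
    (∫ x in a..b, p.derivative.eval x * q.eval x)
      = p.eval b * q.eval b - p.eval a * q.eval a - ∫ x in a..b, p.eval x * q.derivative.eval x := by
  have := integral_mul_deriv_eq_deriv_mul (a := a) (b := b) (u := fun x => p.eval x) (v := fun x => q.eval x)
    (u' := fun x => p.derivative.eval x) (v' := fun x => q.derivative.eval x)
    (fun x _ => p.hasDerivAt x) (fun x _ => q.hasDerivAt x) (poly_ii _ _ _) (poly_ii _ _ _)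
  linarith

theorem rod_ibp (m n : ℕ) (h : n ≤ m) : ∀ v : Polynomial ℝ,
    (∫ x in (-1:ℝ)..1, (Polynomial.derivative^[n] ((Polynomial.X ^ 2 - 1 : Polynomial ℝ) ^ m)).eval x * v.eval x)
    = (-1) ^ n * ∫ x in (-1:ℝ)..1, ((Polynomial.X ^ 2 - 1 : Polynomial ℝ) ^ m).eval x
        * (Polynomial.derivative^[n] v).eval x := by
  induction n with
  | zero => intro v; simp
  | succ n ih =>
    intro v
    rw [Function.iterate_succ_apply', poly_ibp, ih (by omega), (rod_vanish m n (by omega)).1,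
      (rod_vanish m n (by omega)).2, Function.iterate_succ_apply, pow_succ]
    ring

theorem legPoly_orth (m : ℕ) (v : Polynomial ℝ) (hv : v.natDegree < m) :
    (∫ x in (-1:ℝ)..1, (legPoly m).eval x * v.eval x) = 0 := by
  have := rod_ibp m m le_rfl v
  rw [Polynomial.iterate_derivative_eq_zero hv] at this
  simp only [legPoly, Polynomial.eval_mul, Polynomial.eval_C, mul_assoc]
  rw [intervalIntegral.integral_const_mul, this]
  simp

theorem X_deriv_sub_natDegree (m : ℕ) (p : Polynomial ℝ) (hp : p.natDegree ≤ m) (hm : 1 ≤ m) :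
    (Polynomial.X * p.derivative - Polynomial.C (m:ℝ) * p).natDegree < m := by
  rw [show m = (m - 1) + 1 by omega, Nat.lt_succ_iff, Polynomial.natDegree_le_iff_coeff_eq_zero]
  intro N hN
  obtain ⟨n, rfl⟩ : ∃ n, N = n + 1 := ⟨N - 1, by omega⟩
  rw [Polynomial.coeff_sub, Polynomial.coeff_X_mul, Polynomial.coeff_C_mul, Polynomial.coeff_derivative]
  rcases eq_or_lt_of_le (show m ≤ n + 1 by omega) with h | h
  · subst h; rw [show n + 1 - 1 + 1 = n + 1 by omega]; push_cast; ring
  · rw [Polynomial.coeff_eq_zero_of_natDegree_lt (by omega)]; simp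

theorem legPoly_norm (m : ℕ) :
    (∫ x in (-1:ℝ)..1, (legPoly m).eval x * (legPoly m).eval x) = 2 / (2 * (m:ℝ) + 1) := by
  rcases Nat.eq_zero_or_pos m with rfl | hm
  · simp [legPoly]; norm_num
  have h1 := legPoly_orth m _ (X_deriv_sub_natDegree m _ (legPoly_natDegree m) hm)
  have h2 := poly_ibp (Polynomial.X * legPoly m) (legPoly m) (-1) 1
  simp only [Polynomial.derivative_mul, Polynomial.derivative_X, Polynomial.eval_add, Polynomial.eval_mul,
    Polynomial.eval_sub, Polynomial.eval_X, Polynomial.eval_C, Polynomial.eval_one, one_mul,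
    legPoly_eval_one, legPoly_eval_neg_one] at h1 h2
  have c1 : Continuous fun x => (legPoly m).eval x := (legPoly m).continuous
  have c2 : Continuous fun x => (legPoly m).derivative.eval x := (legPoly m).derivative.continuous
  have e1 : (∫ x in (-1:ℝ)..1, (legPoly m).eval x * (x * (legPoly m).derivative.eval x - m * (legPoly m).eval x))
     = (∫ x in (-1:ℝ)..1, x * (legPoly m).eval x * (legPoly m).derivative.eval x)
       - m * ∫ x in (-1:ℝ)..1, (legPoly m).eval x * (legPoly m).eval x := by
    rw [← intervalIntegral.integral_const_mul, ← intervalIntegral.integral_sub]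
    · congr 1; funext x; ring
    · apply Continuous.intervalIntegrable; fun_prop
    · apply Continuous.intervalIntegrable; fun_prop
  have e2 : (∫ x in (-1:ℝ)..1, ((legPoly m).eval x + x * (legPoly m).derivative.eval x) * (legPoly m).eval x)
     = (∫ x in (-1:ℝ)..1, x * (legPoly m).eval x * (legPoly m).derivative.eval x)
       + ∫ x in (-1:ℝ)..1, (legPoly m).eval x * (legPoly m).eval x := by
    rw [← intervalIntegral.integral_add]
    · congr 1; funext x; ring
    · apply Continuous.intervalIntegrable; fun_prop
    · apply Continuous.intervalIntegrable; fun_prop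
  rw [e1] at h1
  rw [e2] at h2
  have h3 : (-1:ℝ) ^ m * (-1) ^ m = 1 := by rw [← mul_pow]; simp
  rw [mul_assoc, h3] at h2
  rw [eq_div_iff (by positivity)]
  linarith

open Polynomial in
/-- Legendre polynomial on the cell `(a,b)`, as a polynomial. -/
noncomputable def lc (m : ℕ) (a b : ℝ) : Polynomial ℝ :=
  (legPoly m).comp (C (2 / (b - a)) * X - C ((a + b) / (b - a)))

theorem lc_eval (m : ℕ) (a b x : ℝ) :
    (lc m a b).eval x = (legPoly m).eval (2 / (b - a) * x - (a + b) / (b - a)) := by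
  simp [lc, Polynomial.eval_comp]

theorem legendreCell_eq (m : ℕ) (a b : ℝ) : legendreCell m a b = fun x => (lc m a b).eval x := by
  funext x
  rw [lc_eval, legendreCell, legendreP_eq]
  congr 1
  ring

theorem lc_derivative_eval (m : ℕ) (a b x : ℝ) :
    (lc m a b).derivative.eval x
      = (2 / (b - a)) * (legPoly m).derivative.eval (2 / (b - a) * x - (a + b) / (b - a)) := by
  simp [lc, Polynomial.derivative_comp, Polynomial.eval_comp]

theorem affine_natDegree (c d : ℝ) :
    (Polynomial.C c * Polynomial.X - Polynomial.C d).natDegree ≤ 1 := by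
  compute_degree

theorem comp_affine_natDegree (p : Polynomial ℝ) (c d : ℝ) :
    (p.comp (Polynomial.C c * Polynomial.X - Polynomial.C d)).natDegree ≤ p.natDegree := by
  refine Polynomial.natDegree_comp_le.trans ?_
  have := affine_natDegree c d
  nlinarith

theorem lc_natDegree (m : ℕ) (a b : ℝ) : (lc m a b).natDegree ≤ m :=
  (comp_affine_natDegree _ _ _).trans (legPoly_natDegree m)

theorem lc_right (m : ℕ) {a b : ℝ} (h : a < b) : (lc m a b).eval b = 1 := by
  have : b - a ≠ 0 := by linarith
  rw [lc_eval, show 2 / (b - a) * b - (a + b) / (b - a) = 1 by field_simp; ring, legPoly_eval_one]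

theorem lc_left (m : ℕ) {a b : ℝ} (h : a < b) : (lc m a b).eval a = (-1) ^ m := by
  have : b - a ≠ 0 := by linarith
  rw [lc_eval, show 2 / (b - a) * a - (a + b) / (b - a) = -1 by field_simp; ring, legPoly_eval_neg_one]

theorem cov {a b : ℝ} (h : a < b) (f : ℝ → ℝ) :
    (∫ x in a..b, f (2 / (b - a) * x - (a + b) / (b - a))) = (b - a) / 2 * ∫ s in (-1:ℝ)..1, f s := by
  have h' : b - a ≠ 0 := by linarith
  rw [intervalIntegral.integral_comp_mul_sub f (by positivity : (2 / (b - a)) ≠ 0),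
    show 2 / (b - a) * b - (a + b) / (b - a) = 1 by field_simp; ring,
    show 2 / (b - a) * a - (a + b) / (b - a) = -1 by field_simp; ring]
  simp

theorem lc_orth (m : ℕ) {a b : ℝ} (h : a < b) (v : Polynomial ℝ) (hv : v.natDegree < m) :
    (∫ x in a..b, (lc m a b).eval x * v.eval x) = 0 := by
  have h' : b - a ≠ 0 := by linarith
  have := cov h (fun s => (legPoly m).eval s *
    (v.comp (Polynomial.C ((b - a) / 2) * Polynomial.X - Polynomial.C (-(a + b) / 2))).eval s)
  rw [legPoly_orth m _ ((comp_affine_natDegree _ _ _).trans_lt hv), mul_zero] at this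
  rw [← this]
  congr 1; funext x
  rw [lc_eval]
  congr 1
  simp only [Polynomial.eval_comp, Polynomial.eval_sub, Polynomial.eval_mul, Polynomial.eval_C, Polynomial.eval_X]
  congr 1
  field_simp
  ring

theorem lc_norm (m : ℕ) {a b : ℝ} (h : a < b) :
    (∫ x in a..b, (lc m a b).eval x * (lc m a b).eval x) = (b - a) / (2 * (m:ℝ) + 1) := by
  have := cov h (fun s => (legPoly m).eval s * (legPoly m).eval s)
  rw [legPoly_norm] at this
  simp only [lc_eval]
  rw [this]; ring

theorem lc_orth_ne {l m : ℕ} {a b : ℝ} (h : a < b) (hlm : l ≠ m) :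
    (∫ x in a..b, (lc l a b).eval x * (lc m a b).eval x) = 0 := by
  rcases lt_or_gt_of_ne hlm with h1 | h1
  · have := lc_orth m h (lc l a b) ((lc_natDegree l a b).trans_lt h1)
    rw [← this]; congr 1; funext x; ring
  · exact lc_orth l h (lc m a b) ((lc_natDegree m a b).trans_lt h1)

theorem lc_coeff_ne (m : ℕ) {a b : ℝ} (h : a < b) : (lc m a b).coeff m ≠ 0 := by
  intro h0
  rcases Nat.eq_zero_or_pos m with rfl | hm
  · have h1 := lc_right 0 h
    rw [Polynomial.eq_C_of_natDegree_le_zero (lc_natDegree 0 a b), h0] at h1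
    simp at h1
  · have h1 : (lc m a b).natDegree < m := by
      refine lt_of_le_of_ne (lc_natDegree m a b) fun he => ?_
      have : (lc m a b) = 0 := by
        rw [← Polynomial.leadingCoeff_eq_zero, Polynomial.leadingCoeff, he, h0]
      rw [this] at he; simp at he; omega
    have h2 := lc_orth m h _ h1
    rw [lc_norm m h] at h2
    have : 0 < (b - a) / (2 * (m:ℝ) + 1) := by have : 0 < b - a := by linarith
                                               positivity
    linarith

theorem lc_span (k : ℕ) {a b : ℝ} (h : a < b) : ∀ p : Polynomial ℝ, p.natDegree ≤ k →
    ∃ c : ℕ → ℝ, p = ∑ l ∈ Finset.range (k + 1), Polynomial.C (c l) * lc l a b := by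
  induction k with
  | zero =>
    intro p hp
    have h1 := lc_right 0 h
    have e1 := Polynomial.eq_C_of_natDegree_le_zero (lc_natDegree 0 a b)
    rw [e1] at h1
    simp only [Polynomial.eval_C] at h1
    refine ⟨fun _ => p.coeff 0, ?_⟩
    simp only [zero_add, Finset.range_one, Finset.sum_singleton]
    rw [e1, h1]
    simp only [map_one, mul_one]
    exact Polynomial.eq_C_of_natDegree_le_zero hp
  | succ k ih =>
    intro p hp
    have hne := lc_coeff_ne (k + 1) h
    set α := p.coeff (k + 1) / (lc (k + 1) a b).coeff (k + 1) with hα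
    obtain ⟨c, hc⟩ := ih (p - Polynomial.C α * lc (k + 1) a b) (by
      rw [Polynomial.natDegree_le_iff_coeff_eq_zero]
      intro N hN
      rw [Polynomial.coeff_sub, Polynomial.coeff_C_mul]
      rcases eq_or_lt_of_le (show k + 1 ≤ N by omega) with h1 | h1
      · subst h1; rw [hα]; field_simp; ring
      · rw [Polynomial.coeff_eq_zero_of_natDegree_lt (by omega),
          Polynomial.coeff_eq_zero_of_natDegree_lt ((lc_natDegree _ _ _).trans_lt h1)]; simp)
    refine ⟨fun l => if l = k + 1 then α else c l, ?_⟩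
    rw [Finset.sum_range_succ]
    have : ∑ l ∈ Finset.range (k + 1), Polynomial.C (if l = k + 1 then α else c l) * lc l a b
        = ∑ l ∈ Finset.range (k + 1), Polynomial.C (c l) * lc l a b := by
      refine Finset.sum_congr rfl fun l hl => ?_
      rw [Finset.mem_range] at hl
      rw [if_neg (by omega)]
    rw [this, ← hc]; simp

/-- Legendre coefficient. -/
noncomputable def lcoef (a b : ℝ) (u : ℝ → ℝ) (l : ℕ) : ℝ :=
  (2 * (l:ℝ) + 1) / (b - a) * ∫ x in a..b, u x * (lc l a b).eval x

theorem lc_expand (k : ℕ) {a b : ℝ} (h : a < b) (p : Polynomial ℝ) (hp : p.natDegree ≤ k) :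
    p = ∑ l ∈ Finset.range (k + 1), Polynomial.C (lcoef a b (fun x => p.eval x) l) * lc l a b := by
  obtain ⟨c, hc⟩ := lc_span k h p hp
  conv_lhs => rw [hc]
  refine Finset.sum_congr rfl fun l hl => ?_
  congr 2
  have : (∫ x in a..b, p.eval x * (lc l a b).eval x) = c l * ((b - a) / (2 * (l:ℝ) + 1)) := by
    have e : ∀ x, p.eval x * (lc l a b).eval x
        = ∑ m ∈ Finset.range (k + 1), c m * ((lc m a b).eval x * (lc l a b).eval x) := by
      intro x
      conv_lhs => rw [hc]
      rw [Polynomial.eval_finsetSum, Finset.sum_mul]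
      refine Finset.sum_congr rfl fun m hm => ?_
      simp; ring
    simp only [e]
    rw [intervalIntegral.integral_finsetSum]
    · rw [Finset.sum_eq_single l]
      · rw [intervalIntegral.integral_const_mul, lc_norm l h]
      · intro m _ hml
        rw [intervalIntegral.integral_const_mul, lc_orth_ne h hml, mul_zero]
      · intro h'; exact absurd hl h'
    · intro m _
      apply Continuous.intervalIntegrable
      have := (lc m a b).continuous
      have := (lc l a b).continuous
      fun_prop
  rw [lcoef, this]
  have : b - a ≠ 0 := by linarith
  field_simp

theorem lc_bound (k : ℕ) : ∃ A : ℝ, 1 ≤ A ∧ ∀ l ≤ k, ∀ a b x : ℝ, a < b → x ∈ Set.Icc a b →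
    |(lc l a b).eval x| ≤ A ∧ |(lc l a b).derivative.eval x| ≤ A * 2 / (b - a) := by
  have h1 : ∀ p : Polynomial ℝ, ∃ B : ℝ, ∀ s ∈ Set.Icc (-1:ℝ) 1, |p.eval s| ≤ B := by
    intro p
    obtain ⟨B, hB⟩ := isCompact_Icc.exists_bound_of_continuousOn (s := Set.Icc (-1:ℝ) 1) p.continuous.continuousOn
    exact ⟨B, hB⟩
  choose B hB using h1
  refine ⟨1 + ∑ l ∈ Finset.range (k + 1), (|B (legPoly l)| + |B (legPoly l).derivative|), ?_, ?_⟩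
  · have : 0 ≤ ∑ l ∈ Finset.range (k + 1), (|B (legPoly l)| + |B (legPoly l).derivative|) :=
      Finset.sum_nonneg fun _ _ => by positivity
    linarith
  · intro l hl a b x hab hx
    have h2 := Finset.single_le_sum (f := fun l => |B (legPoly l)| + |B (legPoly l).derivative|)
      (fun _ _ => by positivity) (Finset.mem_range.2 (Nat.lt_succ_of_le hl))
    have hp : 0 < b - a := by linarith
    have hs : 2 / (b - a) * x - (a + b) / (b - a) ∈ Set.Icc (-1:ℝ) 1 := by
      rw [show 2 / (b - a) * x - (a + b) / (b - a) = (2 * x - (a + b)) / (b - a) by ring]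
      constructor
      · rw [le_div_iff₀ hp]; linarith [hx.1]
      · rw [div_le_iff₀ hp]; linarith [hx.2]
    have e1 := hB (legPoly l) _ hs
    have e2 := hB (legPoly l).derivative _ hs
    have e3 := le_abs_self (B (legPoly l))
    have e4 := le_abs_self (B (legPoly l).derivative)
    have e5 := abs_nonneg (B (legPoly l))
    have e6 := abs_nonneg (B (legPoly l).derivative)
    constructor
    · rw [lc_eval]; linarith
    · rw [lc_derivative_eval, abs_mul, abs_of_pos (by positivity : 0 < 2 / (b - a)), mul_div_assoc, mul_comm]
      apply mul_le_mul_of_nonneg_right _ (by positivity)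
      linarith

theorem lcoef_bound {a b : ℝ} (h : a < b) (u : ℝ → ℝ) (l : ℕ) (A B : ℝ)
    (hA : ∀ x ∈ Set.Icc a b, |(lc l a b).eval x| ≤ A) (hB : ∀ x ∈ Set.Icc a b, |u x| ≤ B) :
    |lcoef a b u l| ≤ (2 * (l:ℝ) + 1) * A * B := by
  have hp : 0 < b - a := by linarith
  have h1 : ‖∫ x in a..b, u x * (lc l a b).eval x‖ ≤ (B * A) * |b - a| := by
    apply intervalIntegral.norm_integral_le_of_norm_le_const
    intro x hx
    rw [Set.uIoc_of_le h.le] at hx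
    have hx' : x ∈ Set.Icc a b := ⟨hx.1.le, hx.2⟩
    rw [Real.norm_eq_abs, abs_mul]
    exact mul_le_mul (hB x hx') (hA x hx') (abs_nonneg _) ((abs_nonneg _).trans (hB x hx'))
  rw [Real.norm_eq_abs, abs_of_pos hp] at h1
  rw [lcoef, abs_mul, abs_of_pos (by positivity : 0 < (2 * (l:ℝ) + 1) / (b - a))]
  calc _ ≤ (2 * (l:ℝ) + 1) / (b - a) * ((B * A) * (b - a)) := by gcongr
    _ = _ := by field_simp

/-- inverse inequalities -/
theorem inv_ineq (k : ℕ) : ∃ K : ℝ, 0 < K ∧ ∀ (a b : ℝ), a < b → ∀ p : Polynomial ℝ, p.natDegree ≤ k →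
    ∀ x ∈ Set.Icc a b, |p.derivative.eval x| ≤ K / (b - a) ^ 2 * ∫ y in a..b, |p.eval y| := by
  obtain ⟨A, hA1, hA⟩ := lc_bound k
  refine ⟨∑ l ∈ Finset.range (k + 1), (2 * (l:ℝ) + 1) * A * (A * 2), ?_, ?_⟩
  · apply Finset.sum_pos
    · intros; positivity
    · simp
  intro a b h p hp x hx
  have hpos : 0 < b - a := by linarith
  have hc : ∀ l ≤ k, |lcoef a b (fun x => p.eval x) l| ≤ (2 * (l:ℝ) + 1) / (b - a) * (A * ∫ y in a..b, |p.eval y|) := by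
    intro l hl
    rw [lcoef, abs_mul, abs_of_pos (by positivity : 0 < (2 * (l:ℝ) + 1) / (b - a))]
    gcongr
    refine (intervalIntegral.abs_integral_le_integral_abs h.le).trans ?_
    rw [← intervalIntegral.integral_const_mul]
    have c1 := p.continuous
    have c2 := (lc l a b).continuous
    apply intervalIntegral.integral_mono_on h.le
    · apply Continuous.intervalIntegrable; fun_prop
    · apply Continuous.intervalIntegrable; fun_prop
    · intro y hy
      rw [abs_mul, mul_comm]
      gcongr
      exact (hA l hl a b y h hy).1
  conv_lhs => rw [lc_expand k h p hp]
  rw [Polynomial.derivative_sum, Polynomial.eval_finsetSum, Finset.sum_div, Finset.sum_mul]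
  refine (Finset.abs_sum_le_sum_abs _ _).trans (Finset.sum_le_sum fun l hl => ?_)
  have hl' : l ≤ k := Nat.lt_succ_iff.1 (Finset.mem_range.1 hl)
  rw [Polynomial.derivative_C_mul, Polynomial.eval_C_mul, abs_mul]
  have hI : 0 ≤ ∫ y in a..b, |p.eval y| := intervalIntegral.integral_nonneg h.le fun _ _ => abs_nonneg _
  calc _ ≤ ((2 * (l:ℝ) + 1) / (b - a) * (A * ∫ y in a..b, |p.eval y|)) * (A * 2 / (b - a)) :=
        mul_le_mul (hc l hl') (hA l hl' a b x h hx).2 (abs_nonneg _) (by positivity)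
    _ = _ := by field_simp

theorem inv_ineq_sup (k : ℕ) : ∃ K : ℝ, 0 < K ∧ ∀ (a b : ℝ), a < b → ∀ p : Polynomial ℝ, p.natDegree ≤ k →
    ∀ B : ℝ, (∀ x ∈ Set.Icc a b, |p.eval x| ≤ B) →
    ∀ x ∈ Set.Icc a b, |p.derivative.eval x| ≤ K * B / (b - a) := by
  obtain ⟨K, hK, h⟩ := inv_ineq k
  refine ⟨K, hK, fun a b hab p hp B hB x hx => (h a b hab p hp x hx).trans ?_⟩
  have hpos : 0 < b - a := by linarith
  have : ∫ y in a..b, |p.eval y| ≤ ∫ y in a..b, B := by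
    apply intervalIntegral.integral_mono_on hab.le
    · apply Continuous.intervalIntegrable
      have := p.continuous
      fun_prop
    · simp
    · exact hB
  simp at this
  calc _ ≤ K / (b - a) ^ 2 * ((b - a) * B) := by gcongr
    _ = _ := by field_simp

theorem gr_formula (k : ℕ) {a b : ℝ} (h : a < b) (u : ℝ → ℝ) (P : Polynomial ℝ) (hP : IsGRProj k a b u P) :
    P = ∑ l ∈ Finset.range k, Polynomial.C (lcoef a b u l) * lc l a b
      + Polynomial.C (u b - ∑ l ∈ Finset.range k, lcoef a b u l) * lc k a b := by
  obtain ⟨h1, h2, h3⟩ := hP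
  have he := lc_expand k h P h1
  have hl : ∀ l ∈ Finset.range k, lcoef a b (fun x => P.eval x) l = lcoef a b u l := by
    intro l hl
    rw [Finset.mem_range] at hl
    unfold lcoef
    rw [h2 _ (by have := lc_natDegree l a b; omega)]
  rw [Finset.sum_range_succ, Finset.sum_congr rfl (fun l hl' => by rw [hl l hl'])] at he
  have h4 : P.eval b = ∑ l ∈ Finset.range k, lcoef a b u l + lcoef a b (fun x => P.eval x) k := by
    conv_lhs => rw [he]
    simp [Polynomial.eval_finsetSum, lc_right _ h]
  have h5 : lcoef a b (fun x => P.eval x) k = u b - ∑ l ∈ Finset.range k, lcoef a b u l := by linarith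
  rw [h5] at he
  exact he

theorem gr_stable (k : ℕ) : ∃ K : ℝ, 0 < K ∧ ∀ (a b : ℝ), a < b → ∀ (u : ℝ → ℝ) (P : Polynomial ℝ),
    IsGRProj k a b u P → ∀ B : ℝ, (∀ x ∈ Set.Icc a b, |u x| ≤ B) →
    ∀ x ∈ Set.Icc a b, |P.eval x| ≤ K * B ∧ |P.derivative.eval x| ≤ K * B / (b - a) := by
  obtain ⟨A, hA1, hA⟩ := lc_bound k
  obtain ⟨K, hK, hKi⟩ := inv_ineq_sup k
  set S := ∑ l ∈ Finset.range k, (2 * (l:ℝ) + 1) * A with hS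
  have hS0 : 0 ≤ S := Finset.sum_nonneg fun _ _ => by positivity
  have hK1 : 0 < S * A + (1 + S) * A := by nlinarith
  refine ⟨(S * A + (1 + S) * A) * (1 + K), by positivity, ?_⟩
  intro a b h u P hP B hB
  have hpos : 0 < b - a := by linarith
  have hB0 : 0 ≤ B := (abs_nonneg _).trans (hB a ⟨le_rfl, h.le⟩)
  have hl : ∀ l ∈ Finset.range k, |lcoef a b u l| ≤ (2 * (l:ℝ) + 1) * A * B := by
    intro l hl
    rw [Finset.mem_range] at hl
    exact lcoef_bound h u l A B (fun x hx => (hA l hl.le a b x h hx).1) hB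
  have hsum : |∑ l ∈ Finset.range k, lcoef a b u l| ≤ S * B := by
    rw [hS, Finset.sum_mul]
    exact (Finset.abs_sum_le_sum_abs _ _).trans (Finset.sum_le_sum hl)
  have main : ∀ x ∈ Set.Icc a b, |P.eval x| ≤ (S * A + (1 + S) * A) * B := by
    intro x hx
    rw [gr_formula k h u P hP, Polynomial.eval_add, Polynomial.eval_finsetSum, Polynomial.eval_C_mul]
    refine (abs_add_le _ _).trans ?_
    have e1 : |∑ l ∈ Finset.range k, (Polynomial.C (lcoef a b u l) * lc l a b).eval x| ≤ S * A * B := by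
      rw [hS, Finset.sum_mul, Finset.sum_mul]
      refine (Finset.abs_sum_le_sum_abs _ _).trans (Finset.sum_le_sum fun l hl' => ?_)
      rw [Polynomial.eval_C_mul, abs_mul]
      calc _ ≤ ((2 * (l:ℝ) + 1) * A * B) * A :=
            mul_le_mul (hl l hl') (hA l (Finset.mem_range.1 hl').le a b x h hx).1 (abs_nonneg _) (by positivity)
        _ = _ := by ring
    have e2 : |u b - ∑ l ∈ Finset.range k, lcoef a b u l| ≤ (1 + S) * B := by
      have := hB b ⟨h.le, le_rfl⟩
      calc _ ≤ |u b| + |∑ l ∈ Finset.range k, lcoef a b u l| := abs_sub _ _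
        _ ≤ _ := by linarith
    rw [abs_mul]
    have e3 := mul_le_mul e2 (hA k le_rfl a b x h hx).1 (abs_nonneg _) (by positivity)
    linarith
  intro x hx
  refine ⟨(main x hx).trans ?_, (hKi a b h P hP.1 _ main x hx).trans ?_⟩
  · have : 0 ≤ (S * A + (1 + S) * A) * B * K := by positivity
    nlinarith
  · apply div_le_div_of_nonneg_right _ hpos.le
    have : 0 ≤ (S * A + (1 + S) * A) * B := by positivity
    nlinarith

theorem poly_antideriv (p : Polynomial ℝ) :
    ∃ Q : Polynomial ℝ, Q.derivative = p ∧ Q.natDegree ≤ p.natDegree + 1 := by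
  refine ⟨∑ i ∈ Finset.range (p.natDegree + 1), Polynomial.C (p.coeff i / ((i:ℝ) + 1)) * Polynomial.X ^ (i + 1), ?_, ?_⟩
  · conv_rhs => rw [p.as_sum_range_C_mul_X_pow]
    rw [Polynomial.derivative_sum]
    refine Finset.sum_congr rfl fun i _ => ?_
    have : (i:ℝ) + 1 ≠ 0 := by positivity
    rw [Polynomial.derivative_C_mul_X_pow]
    push_cast
    rw [div_mul_cancel₀ _ this]
  · apply Polynomial.natDegree_sum_le_of_forall_le
    intro i hi
    refine (Polynomial.natDegree_C_mul_X_pow_le _ _).trans ?_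
    have := Finset.mem_range.1 hi
    omega

theorem mv_bound (g g' : ℝ → ℝ) (hg : ∀ x, HasDerivAt g (g' x) x) {a b : ℝ} (B : ℝ)
    (hB : ∀ x ∈ Set.Icc a b, |g' x| ≤ B) (h0 : g a = 0) (x : ℝ) (hx : x ∈ Set.Icc a b) :
    |g x| ≤ B * (b - a) := by
  have hB0 : 0 ≤ B := (abs_nonneg _).trans (hB x hx)
  have := Convex.norm_image_sub_le_of_norm_hasDerivWithin_le (f := g) (f' := g') (C := B) (s := Set.Icc a b)
    (fun y _ => (hg y).hasDerivWithinAt) hB (convex_Icc a b) (x := a) (y := x) ⟨le_rfl, hx.1.trans hx.2⟩ hx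
  rw [h0, sub_zero, Real.norm_eq_abs, Real.norm_eq_abs, abs_of_nonneg (sub_nonneg.2 hx.1)] at this
  refine this.trans ?_
  gcongr
  exact hx.2

theorem taylor_poly (n : ℕ) : ∀ (f : ℝ → ℝ), ContDiff ℝ (n + 1) f → ∀ (a b M : ℝ),
    (∀ y ∈ Set.Icc a b, |iteratedDeriv (n + 1) f y| ≤ M) →
    ∃ q : Polynomial ℝ, q.natDegree ≤ n ∧ ∀ y ∈ Set.Icc a b,
      |f y - q.eval y| ≤ M * (b - a) ^ (n + 1) ∧ |deriv f y - q.derivative.eval y| ≤ M * (b - a) ^ n := by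
  induction n with
  | zero =>
    intro f hf a b M hM
    have hd : ∀ x, HasDerivAt f (deriv f x) x := fun x =>
      (hf.differentiable (by simp) x).hasDerivAt
    refine ⟨Polynomial.C (f a), by simp, fun y hy => ⟨?_, ?_⟩⟩
    · have := mv_bound (fun y => f y - f a) (deriv f) (fun x => (hd x).sub_const _) M
        (a := a) (b := b) (fun x hx => by simpa using hM x hx) (by simp) y hy
      simpa using this
    · simpa using hM y hy
  | succ n ih =>
    intro f hf a b M hM
    have hd : ∀ x, HasDerivAt f (deriv f x) x := fun x =>
      (hf.differentiable (by simp) x).hasDerivAt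
    have hf' : ContDiff ℝ (n + 1) (deriv f) := by
      have := (contDiff_succ_iff_deriv (n := n + 1) (f := f)).1 (by exact_mod_cast hf)
      exact this.2.2
    obtain ⟨q, hq, hqb⟩ := ih (deriv f) hf' a b M (fun y hy => by
      have := hM y hy
      rwa [iteratedDeriv_succ'] at this)
    obtain ⟨Q, hQ, hQd⟩ := poly_antideriv q
    have hdeg : (Q + Polynomial.C (f a - Q.eval a)).natDegree ≤ n + 1 := by
      refine (Polynomial.natDegree_add_le _ _).trans ?_
      simp; omega
    have hder : (Q + Polynomial.C (f a - Q.eval a)).derivative = q := by simp [hQ]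
    refine ⟨Q + Polynomial.C (f a - Q.eval a), hdeg, fun y hy => ⟨?_, ?_⟩⟩
    · have := mv_bound (fun y => f y - (Q + Polynomial.C (f a - Q.eval a)).eval y)
        (fun y => deriv f y - q.eval y) (fun x => by
          have h2 := (Q + Polynomial.C (f a - Q.eval a)).hasDerivAt x
          rw [hder] at h2
          exact (hd x).sub h2) (M * (b - a) ^ (n + 1)) (a := a) (b := b) (fun x hx => (hqb x hx).1)
          (by simp) y hy
      rw [pow_succ, ← mul_assoc]
      exact this
    · rw [hder]; exact (hqb y hy).1

theorem lcoef_comb (k : ℕ) {a b : ℝ} (h : a < b) (c : ℕ → ℝ) (l : ℕ) (hl : l ≤ k) :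
    lcoef a b (fun x => (∑ l ∈ Finset.range (k + 1), Polynomial.C (c l) * lc l a b).eval x) l = c l := by
  have hl : l ∈ Finset.range (k + 1) := Finset.mem_range.2 (by omega)
  have : (∫ x in a..b, (∑ l ∈ Finset.range (k + 1), Polynomial.C (c l) * lc l a b).eval x * (lc l a b).eval x)
      = c l * ((b - a) / (2 * (l:ℝ) + 1)) := by
    have e : ∀ x, (∑ l ∈ Finset.range (k + 1), Polynomial.C (c l) * lc l a b).eval x * (lc l a b).eval x
        = ∑ m ∈ Finset.range (k + 1), c m * ((lc m a b).eval x * (lc l a b).eval x) := by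
      intro x
      rw [Polynomial.eval_finsetSum, Finset.sum_mul]
      refine Finset.sum_congr rfl fun m hm => ?_
      simp; ring
    simp only [e]
    rw [intervalIntegral.integral_finsetSum]
    · rw [Finset.sum_eq_single l]
      · rw [intervalIntegral.integral_const_mul, lc_norm l h]
      · intro m _ hml
        rw [intervalIntegral.integral_const_mul, lc_orth_ne h hml, mul_zero]
      · intro h'; exact absurd hl h'
    · intro m _
      apply Continuous.intervalIntegrable
      have := (lc m a b).continuous
      have := (lc l a b).continuous
      fun_prop
  rw [lcoef, this]
  have : b - a ≠ 0 := by linarith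
  field_simp

theorem lcoef_sub {a b : ℝ} (u v : ℝ → ℝ) (hu : Continuous u) (hv : Continuous v) (l : ℕ) :
    lcoef a b (fun x => u x - v x) l = lcoef a b u l - lcoef a b v l := by
  unfold lcoef
  rw [← mul_sub, ← intervalIntegral.integral_sub]
  · congr 2; funext x; ring
  · apply Continuous.intervalIntegrable
    have := (lc l a b).continuous
    fun_prop
  · apply Continuous.intervalIntegrable
    have := (lc l a b).continuous
    fun_prop

theorem lcoef_smul {a b : ℝ} (u : ℝ → ℝ) (c : ℝ) (l : ℕ) :
    lcoef a b (fun x => c * u x) l = c * lcoef a b u l := by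
  unfold lcoef
  simp only [mul_assoc, intervalIntegral.integral_const_mul]
  ring

theorem radauCoeff_eq {a b : ℝ} (w : ℝ → ℝ) (hw : Continuous w) (m : ℕ) :
    radauCoeff a b w m = w b - ∑ l ∈ Finset.range m, lcoef a b w l := by
  unfold radauCoeff
  congr 1
  have e : ∀ x, w x * ∑ l ∈ Finset.range m, (2 * (l:ℝ) + 1) * legendreCell l a b x
      = ∑ l ∈ Finset.range m, (2 * (l:ℝ) + 1) * (w x * (lc l a b).eval x) := by
    intro x
    rw [Finset.mul_sum]
    refine Finset.sum_congr rfl fun l _ => ?_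
    rw [legendreCell_eq]; ring
  simp only [e]
  rw [intervalIntegral.integral_finsetSum, Finset.mul_sum]
  · refine Finset.sum_congr rfl fun l _ => ?_
    rw [intervalIntegral.integral_const_mul, lcoef]; ring
  · intro l _
    apply Continuous.intervalIntegrable
    have := (lc l a b).continuous
    fun_prop

theorem radau_poly (k : ℕ) {a b : ℝ} (h : a < b) (q : Polynomial ℝ) (hq : q.natDegree ≤ k) :
    q.eval b - ∑ l ∈ Finset.range (k + 1), lcoef a b (fun x => q.eval x) l = 0 := by
  conv_lhs => enter [1]; rw [lc_expand k h q hq]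
  simp [Polynomial.eval_finsetSum, lc_right _ h]

theorem radau_bound (k : ℕ) : ∃ K : ℝ, 0 < K ∧ ∀ a b : ℝ, a < b → ∀ f : ℝ → ℝ, ContDiff ℝ (k + 1) f →
    ∀ M : ℝ, (∀ y ∈ Set.Icc a b, |iteratedDeriv (k + 1) f y| ≤ M) →
    |radauCoeff a b f (k + 1)| ≤ K * (M * (b - a) ^ (k + 1)) := by
  obtain ⟨A, hA1, hA⟩ := lc_bound k
  have hS0 : 0 ≤ ∑ l ∈ Finset.range (k + 1), (2 * (l:ℝ) + 1) * A := Finset.sum_nonneg fun _ _ => by positivity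
  refine ⟨1 + ∑ l ∈ Finset.range (k + 1), (2 * (l:ℝ) + 1) * A, by linarith, ?_⟩
  intro a b h f hf M hM
  obtain ⟨q, hq, hqb⟩ := taylor_poly k f hf a b M hM
  have e := radau_poly k h q hq
  rw [radauCoeff_eq f hf.continuous]
  have e2 : f b - ∑ l ∈ Finset.range (k + 1), lcoef a b f l
      = (f b - q.eval b) - ∑ l ∈ Finset.range (k + 1), lcoef a b (fun x => f x - q.eval x) l := by
    rw [Finset.sum_congr rfl fun l _ => lcoef_sub f (fun x => q.eval x) hf.continuous q.continuous l,
      Finset.sum_sub_distrib]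
    linarith
  rw [e2, add_mul, one_mul, Finset.sum_mul]
  refine (abs_sub _ _).trans ?_
  refine add_le_add (hqb b ⟨h.le, le_rfl⟩).1 ((Finset.abs_sum_le_sum_abs _ _).trans (Finset.sum_le_sum fun l hl => ?_))
  exact lcoef_bound h _ l A _ (fun x hx => (hA l (Nat.lt_succ_iff.1 (Finset.mem_range.1 hl)) a b x h hx).1)
    (fun x hx => (hqb x hx).1)

/-- coefficients of the Gauss-Radau projection -/
noncomputable def gcoef (k : ℕ) (a b : ℝ) (u : ℝ → ℝ) (l : ℕ) : ℝ :=
  if l = k then u b - ∑ l ∈ Finset.range k, lcoef a b u l else lcoef a b u l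

/-- explicit Gauss-Radau projection -/
noncomputable def grp (k : ℕ) (a b : ℝ) (u : ℝ → ℝ) : Polynomial ℝ :=
  ∑ l ∈ Finset.range (k + 1), Polynomial.C (gcoef k a b u l) * lc l a b

theorem gr_eq (k : ℕ) {a b : ℝ} (h : a < b) (u : ℝ → ℝ) (P : Polynomial ℝ) (hP : IsGRProj k a b u P) :
    P = grp k a b u := by
  rw [gr_formula k h u P hP, grp, Finset.sum_range_succ]
  congr 1
  · refine Finset.sum_congr rfl fun l hl => ?_
    rw [gcoef, if_neg (by have := Finset.mem_range.1 hl; omega)]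
  · simp [gcoef]

theorem grp_natDegree (k : ℕ) (a b : ℝ) (u : ℝ → ℝ) : (grp k a b u).natDegree ≤ k := by
  apply Polynomial.natDegree_sum_le_of_forall_le
  intro l hl
  refine (Polynomial.natDegree_C_mul_le _ _).trans ((lc_natDegree _ _ _).trans ?_)
  have := Finset.mem_range.1 hl
  omega

theorem orth_of_lcoef (k : ℕ) {a b : ℝ} (h : a < b) (g : ℝ → ℝ) (hg : Continuous g)
    (h0 : ∀ l ≤ k, lcoef a b g l = 0) (v : Polynomial ℝ) (hv : v.natDegree ≤ k) :
    (∫ x in a..b, g x * v.eval x) = 0 := by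
  have hpos : 0 < b - a := by linarith
  obtain ⟨c, hc⟩ := lc_span k h v hv
  have e : ∀ x, g x * v.eval x = ∑ l ∈ Finset.range (k + 1), c l * (g x * (lc l a b).eval x) := by
    intro x
    conv_lhs => rw [hc]
    rw [Polynomial.eval_finsetSum, Finset.mul_sum]
    refine Finset.sum_congr rfl fun l _ => ?_
    simp; ring
  simp only [e]
  rw [intervalIntegral.integral_finsetSum]
  · refine Finset.sum_eq_zero fun l hl => ?_
    rw [intervalIntegral.integral_const_mul]
    have := h0 l (Nat.lt_succ_iff.1 (Finset.mem_range.1 hl))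
    rw [lcoef] at this
    rcases mul_eq_zero.1 this with h1 | h1
    · have : 0 < (2 * (l:ℝ) + 1) / (b - a) := by positivity
      linarith
    · rw [h1, mul_zero]
  · intro l _
    apply Continuous.intervalIntegrable
    have := (lc l a b).continuous
    fun_prop

theorem grp_pair (k : ℕ) {a b : ℝ} (h : a < b) (u : ℝ → ℝ) (hu : Continuous u) (v : Polynomial ℝ)
    (hv : v.natDegree ≤ k) :
    (∫ x in a..b, (grp k a b u).eval x * v.eval x)
      = (∫ x in a..b, u x * v.eval x) + radauCoeff a b u (k + 1) * ∫ x in a..b, (lc k a b).eval x * v.eval x := by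
  have c1 := (grp k a b u).continuous
  have c2 := (lc k a b).continuous
  have c3 := v.continuous
  have h0 := orth_of_lcoef k h
    (fun x => ((grp k a b u).eval x - u x) - radauCoeff a b u (k + 1) * (lc k a b).eval x) (by fun_prop)
    (by
      intro l hl
      rw [lcoef_sub _ _ (by fun_prop) (by fun_prop), lcoef_sub _ _ (by fun_prop) hu, lcoef_smul]
      have e1 : lcoef a b (fun x => (grp k a b u).eval x) l = gcoef k a b u l := lcoef_comb k h _ l hl
      have e2 : lcoef a b (fun x => (lc k a b).eval x) l = if l = k then 1 else 0 := by
        have := lcoef_comb k h (fun l => if l = k then 1 else 0) l hl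
        rw [← this]
        congr 1; funext x
        simp
      rw [e1, e2, gcoef, radauCoeff_eq u hu, Finset.sum_range_succ]
      split_ifs with hlk
      · subst hlk; ring
      · ring) v hv
  have e : ∀ x, ((grp k a b u).eval x - u x - radauCoeff a b u (k + 1) * (lc k a b).eval x) * v.eval x
      = (grp k a b u).eval x * v.eval x - u x * v.eval x
        - radauCoeff a b u (k + 1) * ((lc k a b).eval x * v.eval x) := by intro x; ring
  simp only [e] at h0
  rw [intervalIntegral.integral_sub, intervalIntegral.integral_sub, intervalIntegral.integral_const_mul] at h0
  · linarith
  all_goals apply Continuous.intervalIntegrable; fun_prop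

theorem grp_isGR (k : ℕ) {a b : ℝ} (h : a < b) (u : ℝ → ℝ) (hu : Continuous u) :
    IsGRProj k a b u (grp k a b u) := by
  refine ⟨grp_natDegree _ _ _ _, ?_, ?_⟩
  · intro v hv
    rw [grp_pair k h u hu v (by omega), lc_orth k h v (by omega)]; simp
  · rw [grp, Polynomial.eval_finsetSum, Finset.sum_range_succ]
    simp only [Polynomial.eval_C_mul, lc_right _ h, mul_one]
    rw [Finset.sum_congr rfl fun l hl => by
      rw [gcoef, if_neg (by have := Finset.mem_range.1 hl; omega)]]
    simp [gcoef]

theorem radau_deriv_poly (k : ℕ) (hk : 1 ≤ k) {a b : ℝ} (h : a < b) (q P : Polynomial ℝ)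
    (hq : q.natDegree ≤ k + 1)
    (hP : IsGRProj k a b (fun x => q.eval x) P) (r : ℝ) (hr : a < r)
    (h0 : (lc (k + 1) a b).eval r + (lc k a b).eval r = 0) :
    q.derivative.eval r = P.derivative.eval r := by
  obtain ⟨hP1, hP2, hP3⟩ := hP
  set D := q - P with hD
  have hDd : D.natDegree ≤ k + 1 := (Polynomial.natDegree_sub_le _ _).trans (by omega)
  have hDo : ∀ v : Polynomial ℝ, v.natDegree + 1 ≤ k → (∫ x in a..b, D.eval x * v.eval x) = 0 := by
    intro v hv
    have c1 := q.continuous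
    have c2 := P.continuous
    have c3 := v.continuous
    have := hP2 v hv
    simp only [hD, Polynomial.eval_sub, sub_mul]
    rw [intervalIntegral.integral_sub, this, sub_self]
    all_goals apply Continuous.intervalIntegrable; fun_prop
  have hDb : D.eval b = 0 := by simp [hD, hP3]
  set W := (Polynomial.X - Polynomial.C a) * D.derivative with hW
  have hX : (Polynomial.X - Polynomial.C a : Polynomial ℝ).natDegree ≤ 1 := by compute_degree
  have hWd : W.natDegree ≤ k + 1 := by
    refine Polynomial.natDegree_mul_le.trans ?_
    have := Polynomial.natDegree_derivative_le D
    omega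
  have hWo : ∀ v : Polynomial ℝ, v.natDegree + 1 ≤ k → (∫ x in a..b, W.eval x * v.eval x) = 0 := by
    intro v hv
    have e := poly_ibp D ((Polynomial.X - Polynomial.C a) * v) a b
    rw [hDb, hDo] at e
    · simp only [Polynomial.eval_mul, Polynomial.eval_sub, Polynomial.eval_X, Polynomial.eval_C, sub_self,
        zero_mul, mul_zero] at e
      rw [← e]
      congr 1; funext x
      simp [hW]; ring
    · have e1 := Polynomial.natDegree_derivative_le ((Polynomial.X - Polynomial.C a) * v)
      have e2 := Polynomial.natDegree_mul_le (p := (Polynomial.X - Polynomial.C a : Polynomial ℝ)) (q := v)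
      omega
  have hexp := lc_expand (k + 1) h W hWd
  rw [Finset.sum_range_succ, Finset.sum_range_succ, Finset.sum_eq_zero, zero_add] at hexp
  · set α := lcoef a b (fun x => W.eval x) k
    set β := lcoef a b (fun x => W.eval x) (k + 1)
    have ha : W.eval a = 0 := by simp [hW]
    rw [hexp] at ha
    simp only [Polynomial.eval_add, Polynomial.eval_mul, Polynomial.eval_C, lc_left _ h] at ha
    have hαβ : α = β := by
      have : (-1:ℝ) ^ k * (α - β) = 0 := by rw [← ha]; ring
      rcases mul_eq_zero.1 this with h1 | h1
      · exact absurd h1 (by positivity)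
      · linarith
    have hWr : W.eval r = 0 := by
      rw [hexp]
      simp only [Polynomial.eval_add, Polynomial.eval_mul, Polynomial.eval_C]
      rw [hαβ, ← mul_add, add_comm, h0, mul_zero]
    simp only [hW, hD, Polynomial.eval_mul, Polynomial.eval_sub, Polynomial.eval_X, Polynomial.eval_C,
      Polynomial.derivative_sub] at hWr
    rcases mul_eq_zero.1 hWr with h1 | h1
    · linarith
    · linarith
  · intro l hl
    have hl := Finset.mem_range.1 hl
    have hd := lc_natDegree l a b
    rw [lcoef, hWo _ (by omega)]
    simp

theorem radau_deriv (k : ℕ) (hk : 1 ≤ k) : ∃ K : ℝ, 0 < K ∧ ∀ a b : ℝ, a < b → ∀ f : ℝ → ℝ,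
    ContDiff ℝ (k + 2) f → ∀ M : ℝ, (∀ y ∈ Set.Icc a b, |iteratedDeriv (k + 2) f y| ≤ M) →
    ∀ P : Polynomial ℝ, IsGRProj k a b f P → ∀ r ∈ Set.Ioo a b,
    (lc (k + 1) a b).eval r + (lc k a b).eval r = 0 →
    |deriv f r - P.derivative.eval r| ≤ K * (M * (b - a) ^ (k + 1)) := by
  obtain ⟨K, hK, hKb⟩ := gr_stable k
  refine ⟨1 + K, by linarith, ?_⟩
  intro a b h f hf M hM P hP r hr h0
  have hpos : 0 < b - a := by linarith
  obtain ⟨q, hq, hqb⟩ := taylor_poly (k + 1) f (by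
    have : ((k:WithTop ℕ∞) + 2) = ((k + 1 : ℕ) : WithTop ℕ∞) + 1 := by push_cast; rw [add_assoc]; norm_num
    rw [← this]; exact hf) a b M hM
  have hGq := grp_isGR k h (fun x => q.eval x) q.continuous
  set Q := grp k a b (fun x => q.eval x)
  have e1 := radau_deriv_poly k hk h q Q hq hGq r hr.1 h0
  have hPQ : IsGRProj k a b (fun x => f x - q.eval x) (P - Q) := by
    refine ⟨(Polynomial.natDegree_sub_le _ _).trans (max_le hP.1 hGq.1), ?_, ?_⟩
    · intro v hv
      have c1 := P.continuous
      have c2 := Q.continuous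
      have c3 := q.continuous
      have c4 := v.continuous
      have c5 := hf.continuous
      simp only [Polynomial.eval_sub, sub_mul]
      rw [intervalIntegral.integral_sub, intervalIntegral.integral_sub, hP.2.1 v hv, hGq.2.1 v hv]
      all_goals apply Continuous.intervalIntegrable; fun_prop
    · simp [hP.2.2, hGq.2.2]
  have hrI : r ∈ Set.Icc a b := ⟨hr.1.le, hr.2.le⟩
  have e2 := (hKb a b h _ _ hPQ _ (fun x hx => (hqb x hx).1) r hrI).2
  have e3 := (hqb r hrI).2
  rw [Polynomial.derivative_sub, Polynomial.eval_sub, ← e1] at e2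
  have e4 : K * (M * (b - a) ^ (k + 1 + 1)) / (b - a) = K * (M * (b - a) ^ (k + 1)) := by
    field_simp
    ring
  rw [e4] at e2
  calc |deriv f r - P.derivative.eval r|
      = |(deriv f r - q.derivative.eval r) - (P.derivative.eval r - q.derivative.eval r)| := by congr 1; ring
    _ ≤ _ := (abs_sub _ _).trans (by linarith)

theorem int_time_deriv (f g : ℝ → ℝ) (hf : ContDiff ℝ 1 f) (hg : Continuous g) (a b t : ℝ) :
    HasDerivAt (fun s => ∫ y in a..b, f (y - s) * g y) (∫ y in a..b, -(deriv f (y - t)) * g y) t := by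
  have cf := hf.continuous
  have cf' : Continuous (deriv f) := hf.continuous_deriv (by simp)
  have hd : ∀ x, HasDerivAt f (deriv f x) x := fun x => (hf.differentiable (by simp) x).hasDerivAt
  obtain ⟨B, hB⟩ := (isCompact_Icc (a := t - 1) (b := t + 1)).prod (isCompact_uIcc (a := a) (b := b))
    |>.exists_bound_of_continuousOn (f := fun p : ℝ × ℝ => -(deriv f (p.2 - p.1)) * g p.2)
      (Continuous.continuousOn (by fun_prop))
  refine (intervalIntegral.hasDerivAt_integral_of_dominated_loc_of_deriv_le
    (F := fun s y => f (y - s) * g y) (F' := fun s y => -(deriv f (y - s)) * g y) (bound := fun _ => B)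
    (s := Set.Icc (t - 1) (t + 1)) (Icc_mem_nhds (by linarith) (by linarith)) ?_ ?_ ?_ ?_ ?_ ?_).2
  · refine Filter.Eventually.of_forall fun s => Continuous.aestronglyMeasurable (by fun_prop)
  · exact Continuous.intervalIntegrable (by fun_prop) _ _
  · exact Continuous.aestronglyMeasurable (by fun_prop)
  · refine Filter.Eventually.of_forall fun y hy s hs => ?_
    exact hB (s, y) ⟨hs, Set.uIoc_subset_uIcc hy⟩
  · simp
  · refine Filter.Eventually.of_forall fun y hy s hs => ?_
    have h1 : HasDerivAt (fun s : ℝ => y - s) (-1) s := by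
      simpa using (hasDerivAt_id s).const_sub y
    have := ((hd (y - s)).comp s h1).mul_const (g y)
    have e : -deriv f (y - s) * g y = deriv f (y - s) * -1 * g y := by ring
    rw [e]
    exact this

theorem lcoef_time (f : ℝ → ℝ) (hf : ContDiff ℝ 1 f) (a b t : ℝ) (l : ℕ) :
    HasDerivAt (fun s => lcoef a b (fun y => f (y - s)) l) (lcoef a b (fun y => -(deriv f (y - t))) l) t :=
  (int_time_deriv f _ hf (lc l a b).continuous a b t).const_mul _

theorem shift_time (f : ℝ → ℝ) (hf : ContDiff ℝ 1 f) (y t : ℝ) :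
    HasDerivAt (fun s => f (y - s)) (-(deriv f (y - t))) t := by
  have h1 : HasDerivAt (fun s : ℝ => y - s) (-1) t := by
    simpa using (hasDerivAt_id t).const_sub y
  have := ((hf.differentiable (by simp) (y - t)).hasDerivAt).comp t h1
  have e : -deriv f (y - t) = deriv f (y - t) * -1 := by ring
  rw [e]
  exact this

theorem radau_time (f : ℝ → ℝ) (hf : ContDiff ℝ 1 f) (a b t : ℝ) (m : ℕ) :
    HasDerivAt (fun s => radauCoeff a b (fun y => f (y - s)) m)
      (radauCoeff a b (fun y => -(deriv f (y - t))) m) t := by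
  have cf := hf.continuous
  have cf' : Continuous (deriv f) := hf.continuous_deriv (by simp)
  have e : (fun s => radauCoeff a b (fun y => f (y - s)) m)
      = fun s => f (b - s) - ∑ l ∈ Finset.range m, lcoef a b (fun y => f (y - s)) l := by
    funext s
    rw [radauCoeff_eq _ (by fun_prop)]
  rw [e, radauCoeff_eq _ (by fun_prop)]
  exact (shift_time f hf b t).sub (HasDerivAt.fun_sum fun l _ => lcoef_time f hf a b t l)

theorem radau_smul (a b c : ℝ) (f : ℝ → ℝ) (m : ℕ) :
    radauCoeff a b (fun y => c * f y) m = c * radauCoeff a b f m := by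
  unfold radauCoeff
  simp only [mul_assoc, intervalIntegral.integral_const_mul]
  ring

theorem Gfun_eq (k : ℕ) (a b : ℝ) (i : ℕ) (u0 : ℝ → ℝ) (hu : ContDiff ℝ i u0) :
    Gfun k a b u0 i = fun t => radauCoeff a b (fun y => (-1) ^ i * iteratedDeriv i u0 (y - t)) (k + 1) := by
  induction i with
  | zero => funext t; simp [Gfun]
  | succ i ih =>
    funext t
    have h1 := ih (hu.of_le (by exact_mod_cast Nat.le_succ i))
    have h2 : ContDiff ℝ 1 (fun x => (-1) ^ i * iteratedDeriv i u0 x) := by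
      refine contDiff_const.mul ?_
      rw [add_comm i 1] at hu
      rw [iteratedDeriv_eq_iterate]
      exact_mod_cast hu.iterate_deriv' 1 i
    have h3 := (radau_time _ h2 a b t (k + 1)).deriv
    have h4 : Gfun k a b u0 (i + 1) t = deriv (Gfun k a b u0 i) t := by
      unfold Gfun
      rw [iteratedDeriv_succ]
    rw [h4, h1, h3]
    congr 1
    funext y
    rw [deriv_const_mul_field, iteratedDeriv_succ, pow_succ]
    ring

theorem Gfun_deriv (k : ℕ) (a b : ℝ) (i : ℕ) (u0 : ℝ → ℝ) (hu : ContDiff ℝ (i + 1 : ℕ) u0) (t : ℝ) :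
    HasDerivAt (Gfun k a b u0 i) (Gfun k a b u0 (i + 1) t) t := by
  have h1 := Gfun_eq k a b i u0 (hu.of_le (by exact_mod_cast Nat.le_succ i))
  have h2 : ContDiff ℝ 1 (fun x => (-1) ^ i * iteratedDeriv i u0 x) := by
    refine contDiff_const.mul ?_
    rw [add_comm i 1] at hu
    rw [iteratedDeriv_eq_iterate]
    exact_mod_cast hu.iterate_deriv' 1 i
  have h3 := (radau_time _ h2 a b t (k + 1))
  have h4 : Gfun k a b u0 (i + 1) t = deriv (Gfun k a b u0 i) t := by
    unfold Gfun
    rw [iteratedDeriv_succ]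
  rw [h4, h1, h3.deriv]
  exact h3

theorem Gfun_bound (k : ℕ) : ∃ K : ℝ, 0 < K ∧ ∀ a b : ℝ, a < b → ∀ u0 : ℝ → ℝ, ContDiff ℝ (k + 4 : ℕ) u0 →
    ∀ i ≤ 3, ∀ M t : ℝ, (∀ y ∈ Set.Icc a b, |iteratedDeriv (i + (k + 1)) u0 (y - t)| ≤ M) →
    |Gfun k a b u0 i t| ≤ K * (M * (b - a) ^ (k + 1)) := by
  obtain ⟨K, hK, h⟩ := radau_bound k
  refine ⟨K, hK, fun a b hab u0 hu i hi M t hM => ?_⟩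
  rw [Gfun_eq k a b i u0 (hu.of_le (by exact_mod_cast (by omega)))]
  have hc : ContDiff ℝ (k + 1 : ℕ) (iteratedDeriv i u0) := by
    rw [iteratedDeriv_eq_iterate]
    exact (hu.of_le (by exact_mod_cast (by omega : (k + 1) + i ≤ k + 4))).iterate_deriv' (k + 1) i
  have hc2 : ContDiff ℝ (k + 1 : ℕ) (fun y => iteratedDeriv i u0 (y - t)) :=
    hc.comp (contDiff_id.sub contDiff_const)
  simp only [radau_smul]
  rw [abs_mul, abs_pow, abs_neg, abs_one, one_pow, one_mul]
  refine h a b hab _ (by exact_mod_cast hc2) M fun y hy => ?_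
  have e : iteratedDeriv (k + 1) (fun y => iteratedDeriv i u0 (y - t)) y
      = iteratedDeriv (i + (k + 1)) u0 (y - t) := by
    rw [iteratedDeriv_comp_sub_const]
    simp only [iteratedDeriv_eq_iterate]
    rw [← Function.iterate_add_apply, add_comm]
  rw [e]
  exact hM y hy

theorem proj_time (k : ℕ) {a b : ℝ} (h : a < b) (u0 : ℝ → ℝ) (hu : ContDiff ℝ 1 u0)
    (P : ℝ → Polynomial ℝ) (hP : ∀ t, IsGRProj k a b (fun y => u0 (y - t)) (P t)) (y t : ℝ) :
    HasDerivAt (fun s => (P s).eval y) ((grp k a b (fun y => -(deriv u0 (y - t)))).eval y) t := by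
  have e : (fun s => (P s).eval y)
      = fun s => ∑ l ∈ Finset.range (k + 1), gcoef k a b (fun y => u0 (y - s)) l * (lc l a b).eval y := by
    funext s
    rw [gr_eq k h _ _ (hP s), grp, Polynomial.eval_finsetSum]
    simp
  rw [e, grp, Polynomial.eval_finsetSum]
  simp only [Polynomial.eval_C_mul]
  refine HasDerivAt.fun_sum fun l _ => HasDerivAt.mul_const ?_ _
  unfold gcoef
  split_ifs
  · exact (shift_time u0 hu b t).sub (HasDerivAt.fun_sum fun l _ => lcoef_time u0 hu a b t l)
  · exact lcoef_time u0 hu a b t l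

theorem dinv_poly (a b : ℝ) (p : Polynomial ℝ) : ∃ Q : Polynomial ℝ,
    (∀ x, Dinv a b (fun y => p.eval y) x = Q.eval x) ∧ Q.derivative = Polynomial.C (2 / (b - a)) * p ∧
    Q.eval a = 0 := by
  obtain ⟨R, hR, _⟩ := poly_antideriv p
  refine ⟨Polynomial.C (2 / (b - a)) * (R - Polynomial.C (R.eval a)), ?_, ?_, ?_⟩
  · intro x
    rw [Dinv, intervalIntegral.integral_eq_sub_of_hasDerivAt (f := fun y => R.eval y)]
    · simp
    · intro y _
      have := R.hasDerivAt y
      rwa [hR] at this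
    · exact poly_ii _ _ _
  · simp [hR]
  · simp

theorem gr_dinv (k : ℕ) (hk : 1 ≤ k) {a b : ℝ} (h : a < b) (p P : Polynomial ℝ)
    (hP : IsGRProj k a b (Dinv a b (fun y => p.eval y)) P) (h0 : (∫ x in a..b, p.eval x) = 0) :
    P.eval b = 0 ∧ ∀ v : Polynomial ℝ, v.natDegree ≤ k →
      (b - a) / 2 * (∫ x in a..b, P.eval x * v.derivative.eval x) = -∫ x in a..b, p.eval x * v.eval x := by
  have hpos : 0 < b - a := by linarith
  obtain ⟨Q, hQ1, hQ2, hQ3⟩ := dinv_poly a b p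
  obtain ⟨_, hP2, hP3⟩ := hP
  have hb : P.eval b = 0 := by rw [hP3, Dinv, h0, mul_zero]
  refine ⟨hb, fun v hv => ?_⟩
  have := Polynomial.natDegree_derivative_le v
  rw [hP2 _ (by omega)]
  simp only [hQ1]
  have e := poly_ibp Q v a b
  rw [← hQ1 b, ← hP3, hb, hQ3, hQ2] at e
  simp only [Polynomial.eval_C_mul, mul_assoc] at e
  rw [intervalIntegral.integral_const_mul] at e
  simp only [zero_mul, sub_self, zero_sub] at e
  have e' : (∫ x in a..b, Q.eval x * v.derivative.eval x) = -(2 / (b - a) * ∫ x in a..b, p.eval x * v.eval x) := by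
    linarith
  rw [e']
  field_simp

theorem F_struct (k : ℕ) (hk : 2 ≤ k) {a b : ℝ} (h : a < b) (F : ℕ → Polynomial ℝ) (hF : IsFSeq k a b F) :
    (F 1).natDegree ≤ k ∧ (F 2).natDegree ≤ k ∧ (F 1).eval b = 0 ∧ (F 2).eval b = 0 ∧
    ∀ v : Polynomial ℝ, v.natDegree ≤ k →
      (b - a) / 2 * (∫ x in a..b, (F 1).eval x * v.derivative.eval x) = -(∫ x in a..b, (lc k a b).eval x * v.eval x)
      ∧ (b - a) / 2 * (∫ x in a..b, (F 2).eval x * v.derivative.eval x) = ∫ x in a..b, (F 1).eval x * v.eval x := by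
  have hpos : 0 < b - a := by linarith
  obtain ⟨h1, h2⟩ := hF
  have h2 := h2 2 le_rfl
  rw [legendreCell_eq] at h1
  have i0 : (∫ x in a..b, (lc k a b).eval x) = 0 := by
    have := lc_orth k h 1 (by simp; omega)
    simpa using this
  have s1 := gr_dinv k (by omega) h _ _ h1 i0
  have i1 : (∫ x in a..b, (F 1).eval x) = 0 := by
    have := s1.2 Polynomial.X (by simp; omega)
    rw [lc_orth k h Polynomial.X (by simp; omega)] at this
    simp at this
    rcases this with h3 | h3
    · linarith
    · exact h3
  have s2 := gr_dinv k (by omega) h (F 1) _ h2 i1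
  refine ⟨h1.1, by simpa using h2.1, s1.1, by simpa using s2.1, fun v hv => ⟨s1.2 v hv, ?_⟩⟩
  have := s2.2 v hv
  simp only [Polynomial.eval_neg, neg_mul, intervalIntegral.integral_neg] at this
  linarith

theorem Dinv_bound {a b : ℝ} (h : a < b) (v : ℝ → ℝ) (B : ℝ) (hB : ∀ x ∈ Set.Icc a b, |v x| ≤ B)
    (x : ℝ) (hx : x ∈ Set.Icc a b) : |Dinv a b v x| ≤ 2 * B := by
  have hpos : 0 < b - a := by linarith
  have hB0 : 0 ≤ B := (abs_nonneg _).trans (hB x hx)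
  have h1 : ‖∫ y in a..x, v y‖ ≤ B * |x - a| := by
    apply intervalIntegral.norm_integral_le_of_norm_le_const
    intro y hy
    rw [Set.uIoc_of_le hx.1] at hy
    exact hB y ⟨hy.1.le, hy.2.trans hx.2⟩
  rw [Real.norm_eq_abs, abs_of_nonneg (sub_nonneg.2 hx.1 : 0 ≤ x - a)] at h1
  rw [Dinv, abs_mul, abs_of_pos (by positivity : 0 < 2 / (b - a))]
  calc _ ≤ 2 / (b - a) * (B * (b - a)) := by
        gcongr
        refine h1.trans ?_
        gcongr
        exact hx.2
    _ = _ := by field_simp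

theorem F_bound (k : ℕ) : ∃ K : ℝ, 0 < K ∧ ∀ a b : ℝ, a < b → ∀ F : ℕ → Polynomial ℝ, IsFSeq k a b F →
    ∀ x ∈ Set.Icc a b, |(F 1).derivative.eval x| ≤ K / (b - a) ∧ |(F 2).eval x| ≤ K ∧
      |(F 2).derivative.eval x| ≤ K / (b - a) := by
  obtain ⟨A, hA1, hA⟩ := lc_bound k
  obtain ⟨K, hK, hKb⟩ := gr_stable k
  refine ⟨K * (2 * A) + K * (2 * (K * (2 * A))), by positivity, ?_⟩
  intro a b h F hF x hx
  have hpos : 0 < b - a := by linarith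
  obtain ⟨h1, h2⟩ := hF
  have h2 := h2 2 le_rfl
  rw [legendreCell_eq] at h1
  have b1 := hKb a b h _ _ h1 _ (Dinv_bound h _ A fun x hx => (hA k le_rfl a b x h hx).1)
  have b2 := hKb a b h _ _ h2 _ (Dinv_bound h _ _ fun x hx => (b1 x hx).1)
  have c1 := (b1 x hx).2
  have c2 := b2 x hx
  simp only [Polynomial.eval_neg, abs_neg, Polynomial.derivative_neg] at c2
  have p1 : 0 ≤ K * (2 * A) := by positivity
  have p2 : 0 ≤ K * (2 * (K * (2 * A))) := by positivity
  refine ⟨c1.trans ?_, c2.1.trans ?_, c2.2.trans ?_⟩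
  · gcongr; linarith
  · linarith
  · gcongr; linarith

/-- Lagrange basis at integer nodes -/
noncomputable def lagB (k i : ℕ) : Polynomial ℝ :=
  Lagrange.basis (Finset.range (k + 1)) (fun i : ℕ => (i:ℝ)) i

theorem lag_expand (k : ℕ) (p : Polynomial ℝ) (hp : p.natDegree ≤ k) :
    p = ∑ i ∈ Finset.range (k + 1), Polynomial.C (p.eval (i:ℝ)) * lagB k i := by
  have h1 : Set.InjOn (fun i : ℕ => (i:ℝ)) (Finset.range (k + 1)) := fun i _ j _ hij => by simpa using hij
  have := Lagrange.eq_interpolate (f := p) h1 (by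
    rw [Finset.card_range]
    exact Polynomial.degree_le_natDegree.trans_lt (by exact_mod_cast Nat.lt_succ_of_le hp))
  rw [Lagrange.interpolate_apply] at this
  exact this

theorem lagB_natDegree (k i : ℕ) (hi : i ∈ Finset.range (k + 1)) : (lagB k i).natDegree ≤ k := by
  have h1 : Set.InjOn (fun i : ℕ => (i:ℝ)) (Finset.range (k + 1)) := fun i _ j _ hij => by simpa using hij
  have := Lagrange.natDegree_basis h1 hi
  rw [lagB, this]; simp

theorem pair_sum (a b : ℝ) (n : ℕ) (c d : ℕ → ℝ) (B : ℕ → Polynomial ℝ) :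
    (∫ x in a..b, (∑ i ∈ Finset.range n, Polynomial.C (c i) * B i).eval x
      * (∑ i ∈ Finset.range n, Polynomial.C (d i) * B i).eval x)
    = ∑ i ∈ Finset.range n, ∑ j ∈ Finset.range n, c i * d j * ∫ x in a..b, (B i).eval x * (B j).eval x := by
  have e : ∀ x, (∑ i ∈ Finset.range n, Polynomial.C (c i) * B i).eval x
      * (∑ i ∈ Finset.range n, Polynomial.C (d i) * B i).eval x
      = ∑ i ∈ Finset.range n, ∑ j ∈ Finset.range n, c i * d j * ((B i).eval x * (B j).eval x) := by
    intro x
    simp only [Polynomial.eval_finsetSum, Polynomial.eval_C_mul, Finset.sum_mul_sum]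
    refine Finset.sum_congr rfl fun i _ => Finset.sum_congr rfl fun j _ => by ring
  simp only [e]
  have hc : ∀ i j : ℕ, Continuous fun x => c i * d j * ((B i).eval x * (B j).eval x) := by
    intro i j
    have := (B i).continuous
    have := (B j).continuous
    fun_prop
  rw [intervalIntegral.integral_finsetSum]
  · refine Finset.sum_congr rfl fun i _ => ?_
    rw [intervalIntegral.integral_finsetSum]
    · refine Finset.sum_congr rfl fun j _ => ?_
      rw [intervalIntegral.integral_const_mul]
    · intro j _; exact (hc i j).intervalIntegrable _ _
  · intro i _
    exact (continuous_finsetSum _ fun j _ => hc i j).intervalIntegrable _ _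

theorem poly_time (k : ℕ) (p : ℝ → Polynomial ℝ) (hp : ∀ s, (p s).natDegree ≤ k) (p' : ℝ → ℝ) (t : ℝ)
    (h : ∀ y, HasDerivAt (fun s => (p s).eval y) (p' y) t) :
    ∃ q : Polynomial ℝ, q.natDegree ≤ k ∧ (∀ y, p' y = q.eval y) ∧
      ∀ a b : ℝ, HasDerivAt (fun s => ∫ x in a..b, (p s).eval x ^ 2)
        (2 * ∫ x in a..b, q.eval x * (p t).eval x) t := by
  refine ⟨∑ i ∈ Finset.range (k + 1), Polynomial.C (p' (i:ℝ)) * lagB k i, ?_, ?_, ?_⟩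
  · apply Polynomial.natDegree_sum_le_of_forall_le
    intro l hl
    exact (Polynomial.natDegree_C_mul_le _ _).trans (lagB_natDegree k l hl)
  · intro y
    refine (h y).unique ?_
    have e : (fun s => (p s).eval y)
        = fun s => ∑ i ∈ Finset.range (k + 1), (p s).eval (i:ℝ) * (lagB k i).eval y := by
      funext s
      conv_lhs => rw [lag_expand k (p s) (hp s)]
      simp [Polynomial.eval_finsetSum]
    rw [e, Polynomial.eval_finsetSum]
    simp only [Polynomial.eval_C_mul]
    exact HasDerivAt.fun_sum fun i _ => (h i).mul_const _
  · intro a b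
    have e : (fun s => ∫ x in a..b, (p s).eval x ^ 2) = fun s => ∑ i ∈ Finset.range (k + 1),
        ∑ j ∈ Finset.range (k + 1), (p s).eval (i:ℝ) * (p s).eval (j:ℝ)
          * ∫ x in a..b, (lagB k i).eval x * (lagB k j).eval x := by
      funext s
      rw [← pair_sum, ← lag_expand k (p s) (hp s)]
      simp only [sq]
    rw [e]
    have hd : HasDerivAt (fun s => ∑ i ∈ Finset.range (k + 1),
        ∑ j ∈ Finset.range (k + 1), (p s).eval (i:ℝ) * (p s).eval (j:ℝ)
          * ∫ x in a..b, (lagB k i).eval x * (lagB k j).eval x)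
        (∑ i ∈ Finset.range (k + 1), ∑ j ∈ Finset.range (k + 1),
          (p' (i:ℝ) * (p t).eval (j:ℝ) + (p t).eval (i:ℝ) * p' (j:ℝ))
          * ∫ x in a..b, (lagB k i).eval x * (lagB k j).eval x) t :=
      HasDerivAt.fun_sum fun i _ => HasDerivAt.fun_sum fun j _ => ((h i).mul (h j)).mul_const _
    convert hd using 1
    simp only [add_mul, Finset.sum_add_distrib]
    rw [← pair_sum a b (k + 1) (fun i => p' (i:ℝ)) (fun i => (p t).eval (i:ℝ)),
      ← pair_sum a b (k + 1) (fun i => (p t).eval (i:ℝ)) (fun i => p' (i:ℝ)), ← lag_expand k (p t) (hp t), two_mul]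
    congr 2
    funext x
    ring

/-- The error `u_h - u_I^2` on a cell, as a polynomial. -/
noncomputable def errP (k : ℕ) (a b : ℝ) (u0 : ℝ → ℝ) (P : ℝ → Polynomial ℝ) (F : ℕ → Polynomial ℝ)
    (uh : ℝ → Polynomial ℝ) (t : ℝ) : Polynomial ℝ :=
  uh t - P t + Polynomial.C ((b - a) / 2 * Gfun k a b u0 1 t) * F 1
    + Polynomial.C (((b - a) / 2) ^ 2 * Gfun k a b u0 2 t) * F 2

theorem errP_eval (k : ℕ) (a b : ℝ) (u0 : ℝ → ℝ) (P : ℝ → Polynomial ℝ) (F : ℕ → Polynomial ℝ)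
    (uh : ℝ → Polynomial ℝ) (t y : ℝ) :
    (errP k a b u0 P F uh t).eval y = (uh t).eval y - uIl k a b u0 P F 2 y t := by
  have : Finset.Icc 1 2 = ({1, 2} : Finset ℕ) := by decide
  simp only [errP, uIl, wSum, wFun, this]
  simp
  ring

theorem int_add4 (a b : ℝ) (f1 f2 f3 f4 : ℝ → ℝ) (h1 : Continuous f1) (h2 : Continuous f2)
    (h3 : Continuous f3) (h4 : Continuous f4) (c d : ℝ) :
    (∫ x in a..b, (f1 x - f2 x + c * f3 x + d * f4 x))
      = (∫ x in a..b, f1 x) - (∫ x in a..b, f2 x) + c * (∫ x in a..b, f3 x) + d * ∫ x in a..b, f4 x := by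
  rw [intervalIntegral.integral_add, intervalIntegral.integral_add, intervalIntegral.integral_sub,
    intervalIntegral.integral_const_mul, intervalIntegral.integral_const_mul]
  all_goals apply Continuous.intervalIntegrable; fun_prop

theorem cell_energy (k : ℕ) (hk : 2 ≤ k) {a b : ℝ} (h : a < b) (u0 : ℝ → ℝ) (hu : ContDiff ℝ (k + 4 : ℕ) u0)
    (P : ℝ → Polynomial ℝ) (hP : ∀ t, IsGRProj k a b (fun y => u0 (y - t)) (P t))
    (F : ℕ → Polynomial ℝ) (hF : IsFSeq k a b F) (uh : ℝ → Polynomial ℝ)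
    (hd : ∀ t, (uh t).natDegree ≤ k) (hc : ∀ y, ContDiff ℝ 1 (fun t => (uh t).eval y)) (t uin : ℝ)
    (hDG : ∀ v : Polynomial ℝ, v.natDegree ≤ k →
      (∫ y in a..b, deriv (fun s => (uh s).eval y) t * v.eval y)
      - (∫ y in a..b, (uh t).eval y * v.derivative.eval y)
      + (uh t).eval b * v.eval b - uin * v.eval a = 0) :
    ∃ D : ℝ, HasDerivAt (fun s => ∫ y in a..b, (errP k a b u0 P F uh s).eval y ^ 2) D t ∧
      D ≤ (uin - u0 (a - t)) ^ 2 - (errP k a b u0 P F uh t).eval b ^ 2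
        + 2 * (((b - a) / 2) ^ 2 * Gfun k a b u0 3 t * ∫ y in a..b, (F 2).eval y * (errP k a b u0 P F uh t).eval y) := by
  obtain ⟨hF1, hF2, hF1b, hF2b, hFv⟩ := F_struct k hk h F hF
  have hu1 : ContDiff ℝ 1 u0 := hu.of_le (by exact_mod_cast (by omega))
  have cu := hu1.continuous
  have cu' : Continuous (deriv u0) := hu1.continuous_deriv (by simp)
  have hud : ∀ y, HasDerivAt (fun s => (uh s).eval y) (deriv (fun s => (uh s).eval y) t) t := fun y =>
    ((hc y).differentiable (by simp) t).hasDerivAt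
  obtain ⟨qh, hqhd, hqh, -⟩ := poly_time k uh hd _ t hud
  set f : ℝ → ℝ := fun y => -(deriv u0 (y - t)) with hf
  have cf : Continuous f := by fun_prop
  set G1 := Gfun k a b u0 1 t
  set G2 := Gfun k a b u0 2 t with hG2
  set G3 := Gfun k a b u0 3 t with hG3
  have hEd : ∀ s, (errP k a b u0 P F uh s).natDegree ≤ k := by
    intro s
    unfold errP
    refine (Polynomial.natDegree_add_le _ _).trans (max_le ((Polynomial.natDegree_add_le _ _).trans
      (max_le ((Polynomial.natDegree_sub_le _ _).trans (max_le (hd s) (hP s).1)) ?_)) ?_)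
    · exact (Polynomial.natDegree_C_mul_le _ _).trans hF1
    · exact (Polynomial.natDegree_C_mul_le _ _).trans hF2
  have hEt : ∀ y, HasDerivAt (fun s => (errP k a b u0 P F uh s).eval y)
      (qh.eval y - (grp k a b f).eval y + (b - a) / 2 * G2 * (F 1).eval y
        + ((b - a) / 2) ^ 2 * G3 * (F 2).eval y) t := by
    intro y
    unfold errP
    simp only [Polynomial.eval_add, Polynomial.eval_sub, Polynomial.eval_C_mul]
    have d1 := Gfun_deriv k a b 1 u0 (hu.of_le (by exact_mod_cast (by omega))) t
    have d2 := Gfun_deriv k a b 2 u0 (hu.of_le (by exact_mod_cast (by omega))) t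
    have d0 := hud y
    rw [hqh y] at d0
    exact ((d0.sub (proj_time k h u0 hu1 P hP y t)).add ((d1.const_mul _).mul_const _)).add
      ((d2.const_mul _).mul_const _)
  obtain ⟨q, hqd, hq, hqE⟩ := poly_time k _ hEd _ t hEt
  refine ⟨_, hqE a b, ?_⟩
  set E := errP k a b u0 P F uh t with hE
  -- the weak form with test function E
  have t1 := hDG E (hEd t)
  simp only [hqh] at t1
  have cE := E.continuous
  have cE' := E.derivative.continuous
  have cqh := qh.continuous
  have cg := (grp k a b f).continuous
  have cF1 := (F 1).continuous
  have cF2 := (F 2).continuous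
  have cuh := (uh t).continuous
  have cP := (P t).continuous
  have t2 : (∫ x in a..b, q.eval x * E.eval x) = (∫ x in a..b, qh.eval x * E.eval x)
      - (∫ x in a..b, (grp k a b f).eval x * E.eval x) + (b - a) / 2 * G2 * (∫ x in a..b, (F 1).eval x * E.eval x)
      + ((b - a) / 2) ^ 2 * G3 * ∫ x in a..b, (F 2).eval x * E.eval x := by
    rw [← int_add4 a b _ _ _ _ (by fun_prop) (by fun_prop) (by fun_prop) (by fun_prop)]
    congr 1; funext x
    rw [← hq x]; ring
  have t3 := grp_pair k h f cf E (hEd t)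
  have hR : radauCoeff a b f (k + 1) = G1 := by
    have := congrFun (Gfun_eq k a b 1 u0 (by exact_mod_cast hu1)) t
    simp only [G1]
    rw [this]
    congr 1; funext y
    simp [hf]
  rw [hR] at t3
  -- integrate u by parts
  have t4 : (∫ x in a..b, f x * E.eval x) = (∫ x in a..b, u0 (x - t) * E.derivative.eval x)
      - u0 (b - t) * E.eval b + u0 (a - t) * E.eval a := by
    have := integral_mul_deriv_eq_deriv_mul (a := a) (b := b) (u := fun x => u0 (x - t)) (v := fun x => E.eval x)
      (u' := fun x => deriv u0 (x - t)) (v' := fun x => E.derivative.eval x)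
      (fun x _ => by
        have h1 : HasDerivAt (fun x : ℝ => x - t) 1 x := (hasDerivAt_id x).sub_const t
        have := ((hu1.differentiable (by simp) (x - t)).hasDerivAt).comp x h1
        rw [mul_one] at this
        exact this) (fun x _ => E.hasDerivAt x)
        (Continuous.intervalIntegrable (by fun_prop) _ _) (poly_ii _ _ _)
    simp only [hf, neg_mul, intervalIntegral.integral_neg]
    linarith
  have t5 := (hP t).2.1 E.derivative (by
    have := Polynomial.natDegree_derivative_le E
    have h3 : E.natDegree ≤ k := hEd t
    omega)
  have t6 : (∫ x in a..b, E.eval x * E.derivative.eval x) = (∫ x in a..b, (uh t).eval x * E.derivative.eval x)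
      - (∫ x in a..b, (P t).eval x * E.derivative.eval x)
      + (b - a) / 2 * G1 * (∫ x in a..b, (F 1).eval x * E.derivative.eval x)
      + ((b - a) / 2) ^ 2 * G2 * ∫ x in a..b, (F 2).eval x * E.derivative.eval x := by
    rw [← int_add4 a b _ _ _ _ (by fun_prop) (by fun_prop) (by fun_prop) (by fun_prop)]
    congr 1; funext x
    have : E.eval x = (uh t).eval x - (P t).eval x + (b - a) / 2 * G1 * (F 1).eval x
      + ((b - a) / 2) ^ 2 * G2 * (F 2).eval x := by
      rw [hE, errP]
      simp only [Polynomial.eval_add, Polynomial.eval_sub, Polynomial.eval_C_mul]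
      rfl
    rw [this]; ring
  have t7 : (∫ x in a..b, E.eval x * E.derivative.eval x) = (E.eval b ^ 2 - E.eval a ^ 2) / 2 := by
    have := poly_ibp E E a b
    have e : (∫ x in a..b, E.derivative.eval x * E.eval x) = ∫ x in a..b, E.eval x * E.derivative.eval x := by
      congr 1; funext x; ring
    rw [e] at this
    linarith
  have t8 : E.eval b = (uh t).eval b - u0 (b - t) := by
    rw [hE, errP]
    simp only [Polynomial.eval_add, Polynomial.eval_sub, Polynomial.eval_C_mul, hF1b, hF2b, (hP t).2.2]
    ring
  obtain ⟨v1, v2⟩ := hFv E (hEd t)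
  have v1' : (b - a) / 2 * G1 * (∫ x in a..b, (F 1).eval x * E.derivative.eval x)
      = -(G1 * ∫ x in a..b, (lc k a b).eval x * E.eval x) := by
    rw [mul_right_comm, v1]; ring
  have v2' : ((b - a) / 2) ^ 2 * G2 * (∫ x in a..b, (F 2).eval x * E.derivative.eval x)
      = (b - a) / 2 * G2 * ∫ x in a..b, (F 1).eval x * E.eval x := by
    rw [← v2]; ring
  have hEbb : E.eval b * E.eval b = (uh t).eval b * E.eval b - u0 (b - t) * E.eval b := by
    rw [← sub_mul, ← t8]
  have key : (∫ x in a..b, q.eval x * E.eval x) = (E.eval b ^ 2 - E.eval a ^ 2) / 2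
      - E.eval b * E.eval b + (uin - u0 (a - t)) * E.eval a
      + ((b - a) / 2) ^ 2 * G3 * ∫ x in a..b, (F 2).eval x * E.eval x := by
    rw [sub_mul]
    linarith
  rw [key]
  nlinarith [sq_nonneg (E.eval a - (uin - u0 (a - t)))]

theorem cs_abs {a b : ℝ} (h : a < b) (f : ℝ → ℝ) (hf : Continuous f) :
    (∫ y in a..b, |f y|) ≤ Real.sqrt (b - a) * Real.sqrt (∫ y in a..b, f y ^ 2) := by
  have hpos : 0 < b - a := by linarith
  rw [← Real.sqrt_mul hpos.le]
  apply Real.le_sqrt_of_sq_le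
  set I := ∫ y in a..b, |f y|
  have h1 : 0 ≤ ∫ y in a..b, (|f y| - I / (b - a)) ^ 2 :=
    intervalIntegral.integral_nonneg h.le fun _ _ => sq_nonneg _
  have e : ∀ y, (|f y| - I / (b - a)) ^ 2 = f y ^ 2 - (2 * (I / (b - a))) * |f y| + (I / (b - a)) ^ 2 := by
    intro y; rw [sub_sq, sq_abs]; ring
  simp only [e] at h1
  rw [intervalIntegral.integral_add, intervalIntegral.integral_sub, intervalIntegral.integral_const_mul,
    intervalIntegral.integral_const] at h1
  · change 0 ≤ _ - 2 * (I / (b - a)) * I + _ at h1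
    rw [smul_eq_mul] at h1
    have : (b - a) * (∫ y in a..b, f y ^ 2) - I ^ 2
        = (b - a) * ((∫ y in a..b, f y ^ 2) - 2 * (I / (b - a)) * I + (b - a) * (I / (b - a)) ^ 2) := by
      field_simp; ring
    have := mul_nonneg hpos.le h1
    linarith
  all_goals apply Continuous.intervalIntegrable; fun_prop

theorem sqrt_gronwall (S D : ℝ → ℝ) (T R : ℝ) (hS : ∀ t ∈ Set.Icc 0 T, HasDerivAt S (D t) t)
    (hS0 : ∀ t, 0 ≤ S t) (hR : 0 ≤ R) (hD : ∀ t ∈ Set.Icc 0 T, D t ≤ 2 * R * Real.sqrt (S t)) :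
    ∀ t ∈ Set.Icc 0 T, Real.sqrt (S t) ≤ Real.sqrt (S 0) + R * t := by
  intro t ht
  apply le_of_forall_pos_le_add
  intro ε hε
  have hpos : ∀ s, 0 < S s + ε ^ 2 := fun s => by have := hS0 s; positivity
  have hder : ∀ s ∈ Set.Icc 0 T, HasDerivAt (fun s => Real.sqrt (S s + ε ^ 2))
      (D s / (2 * Real.sqrt (S s + ε ^ 2))) s := fun s hs =>
    ((hS s hs).add_const _).sqrt (hpos s).ne'
  have hmono : ∀ s ∈ Set.Icc 0 T, D s / (2 * Real.sqrt (S s + ε ^ 2)) ≤ R := by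
    intro s hs
    have h1 := Real.sqrt_pos.2 (hpos s)
    rw [div_le_iff₀ (by positivity)]
    have h2 : Real.sqrt (S s) ≤ Real.sqrt (S s + ε ^ 2) := Real.sqrt_le_sqrt (by nlinarith)
    have := hD s hs
    nlinarith
  have hcvx : Convex ℝ (Set.Icc 0 T) := convex_Icc 0 T
  have := hcvx.image_sub_le_mul_sub_of_deriv_le (f := fun s => Real.sqrt (S s + ε ^ 2)) (C := R)
    (fun s hs => (hder s hs).continuousAt.continuousWithinAt)
    (fun s hs => (hder s (interior_subset hs)).differentiableAt.differentiableWithinAt)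
    (fun s hs => by rw [(hder s (interior_subset hs)).deriv]; exact hmono s (interior_subset hs))
    0 ⟨le_rfl, ht.1.trans ht.2⟩ t ht ht.1
  simp only [sub_zero] at this
  have h1 : Real.sqrt (S t) ≤ Real.sqrt (S t + ε ^ 2) := Real.sqrt_le_sqrt (by nlinarith)
  have h2 : Real.sqrt (S 0 + ε ^ 2) ≤ Real.sqrt (S 0) + ε := by
    exact Real.sqrt_le_iff.2 ⟨by positivity, by nlinarith [Real.sq_sqrt (hS0 0), Real.sqrt_nonneg (S 0)]⟩
  linarith

theorem tele_Icc (f : ℕ → ℝ) (N : ℕ) : ∑ j ∈ Finset.Icc 1 N, (f j - f (j - 1)) = f N - f 0 := by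
  induction N with
  | zero => simp
  | succ n ih =>
    rw [Finset.sum_Icc_succ_top (by omega), ih]
    simp

theorem errP_natDegree (k : ℕ) (hk : 2 ≤ k) {a b : ℝ} (h : a < b) (u0 : ℝ → ℝ)
    (P : ℝ → Polynomial ℝ) (hP : ∀ t, IsGRProj k a b (fun y => u0 (y - t)) (P t))
    (F : ℕ → Polynomial ℝ) (hF : IsFSeq k a b F) (uh : ℝ → Polynomial ℝ)
    (hd : ∀ t, (uh t).natDegree ≤ k) (s : ℝ) : (errP k a b u0 P F uh s).natDegree ≤ k := by
  obtain ⟨hF1, hF2, hF1b, hF2b, hFv⟩ := F_struct k hk h F hF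
  unfold errP
  refine (Polynomial.natDegree_add_le _ _).trans (max_le ((Polynomial.natDegree_add_le _ _).trans
    (max_le ((Polynomial.natDegree_sub_le _ _).trans (max_le (hd s) (hP s).1)) ?_)) ?_)
  · exact (Polynomial.natDegree_C_mul_le _ _).trans hF1
  · exact (Polynomial.natDegree_C_mul_le _ _).trans hF2

theorem errP_right (k : ℕ) (hk : 2 ≤ k) {a b : ℝ} (h : a < b) (u0 : ℝ → ℝ)
    (P : ℝ → Polynomial ℝ) (hP : ∀ t, IsGRProj k a b (fun y => u0 (y - t)) (P t))
    (F : ℕ → Polynomial ℝ) (hF : IsFSeq k a b F) (uh : ℝ → Polynomial ℝ) (t : ℝ) :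
    (errP k a b u0 P F uh t).eval b = (uh t).eval b - u0 (b - t) := by
  obtain ⟨hF1, hF2, hF1b, hF2b, hFv⟩ := F_struct k hk h F hF
  rw [errP]
  simp only [Polynomial.eval_add, Polynomial.eval_sub, Polynomial.eval_C_mul, hF1b, hF2b, (hP t).2.2]
  ring

/-- mesh facts -/
theorem mesh_facts (N : ℕ) (x : ℕ → ℝ) (h0 : x 0 = 0) (hN : x N = 2 * Real.pi)
    (hx : ∀ j < N, x j < x (j + 1)) :
    ∀ j ∈ Finset.Icc 1 N, x (j - 1) < x j ∧ 0 ≤ x (j - 1) ∧ x j ≤ 2 * Real.pi := by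
  have hm : ∀ n i, i + n ≤ N → x i ≤ x (i + n) := by
    intro n
    induction n with
    | zero => intro i _; simp
    | succ n ih =>
      intro i hi
      have h1 := ih i (by omega)
      have h2 := hx (i + n) (by omega)
      rw [← add_assoc]
      linarith
  intro j hj
  rw [Finset.mem_Icc] at hj
  refine ⟨?_, ?_, ?_⟩
  · have := hx (j - 1) (by omega)
    rwa [Nat.sub_add_cancel hj.1] at this
  · have := hm (j - 1) 0 (by omega)
    rwa [h0, zero_add] at this
  · have := hm (N - j) j (by omega)
    rwa [Nat.add_sub_cancel' hj.2, hN] at this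

theorem flux_sum (N : ℕ) (hN : 1 ≤ N) (e ein : ℕ → ℝ) (h1 : ∀ j, 2 ≤ j → j ≤ N → ein j = e (j - 1))
    (h2 : ein 1 = 0 ∨ ein 1 = e N) : ∑ j ∈ Finset.Icc 1 N, (ein j ^ 2 - e j ^ 2) ≤ 0 := by
  have h3 : ∑ j ∈ Finset.Icc 1 N, (ein j ^ 2 - e j ^ 2)
      = -∑ j ∈ Finset.Icc 1 N, ((fun j : ℕ => (if j = 0 then ein 1 else e j) ^ 2) j
          - (fun j : ℕ => (if j = 0 then ein 1 else e j) ^ 2) (j - 1)) := by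
    rw [← Finset.sum_neg_distrib]
    refine Finset.sum_congr rfl fun j hj => ?_
    rw [Finset.mem_Icc] at hj
    by_cases h : j = 1
    · subst h; simp
    · have a1 : j ≠ 0 := by omega
      have a2 : j - 1 ≠ 0 := by omega
      simp only [a1, a2, if_false, h1 j (by omega) hj.2]
      ring
  rw [h3, tele_Icc]
  have : N ≠ 0 := by omega
  simp only [this, if_false, if_true]
  rcases h2 with h2 | h2 <;> rw [h2]
  · nlinarith [sq_nonneg (e N)]
  · simp

theorem l2_bound (k : ℕ) (hk : 2 ≤ k) : ∃ K : ℝ, 0 < K ∧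
      ∀ (N : ℕ) (x : ℕ → ℝ) (h T : ℝ), 1 ≤ N → x 0 = 0 → x N = 2 * Real.pi →
        (∀ j < N, x j < x (j+1)) →
        (∀ j ∈ Finset.Icc 1 N, x j - x (j-1) ≤ h) → 0 < h →
        0 < T →
        ∀ u0 : ℝ → ℝ, ContDiff ℝ (k+4 : ℕ) u0 →
        ∀ M : ℝ, 0 ≤ M →
          (∀ i ≤ k+4, ∀ y ∈ Set.Icc (-T) (2 * Real.pi), |iteratedDeriv i u0 y| ≤ M) →
        ∀ P : ℕ → ℝ → Polynomial ℝ,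
          (∀ j ∈ Finset.Icc 1 N, ∀ t : ℝ,
            IsGRProj k (x (j-1)) (x j) (fun y => u0 (y - t)) (P j t)) →
        ∀ F : ℕ → ℕ → Polynomial ℝ,
          (∀ j ∈ Finset.Icc 1 N, IsFSeq k (x (j-1)) (x j) (F j)) →
        ∀ (inflow : ℝ → ℝ) (uh : ℕ → ℝ → Polynomial ℝ),
          IsDGSol k N x T inflow uh →
          (((∀ t, inflow t = (uh N t).eval (x N))
              ∧ (∀ y : ℝ, u0 (y + 2 * Real.pi) = u0 y))
            ∨ (∀ t, inflow t = u0 (-t))) →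
        ∀ t ∈ Set.Icc (0:ℝ) T,
          Real.sqrt (∑ j ∈ Finset.Icc 1 N, ∫ y in (x (j-1))..(x j),
              (errP k (x (j-1)) (x j) u0 (P j) (F j) (uh j) t).eval y ^ 2)
          ≤ Real.sqrt (∑ j ∈ Finset.Icc 1 N, ∫ y in (x (j-1))..(x j),
              (errP k (x (j-1)) (x j) u0 (P j) (F j) (uh j) 0).eval y ^ 2) + K * h ^ (k + 3) * M * t := by
  obtain ⟨KG, hKG, HG⟩ := Gfun_bound k
  obtain ⟨KF, hKF, HF⟩ := F_bound k
  have hpi := Real.pi_pos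
  refine ⟨KG * KF * Real.sqrt (2 * Real.pi), by positivity, ?_⟩
  intro N x h T hN hx0 hxN hx hh hpos hT u0 hu M hM0 hM P hP F hF inflow uh hDG hbc
  have mf := mesh_facts N x hx0 hxN hx
  set E : ℕ → ℝ → Polynomial ℝ := fun j t => errP k (x (j-1)) (x j) u0 (P j) (F j) (uh j) t with hE
  set uin : ℕ → ℝ → ℝ := fun j t => if j = 1 then inflow t else (uh (j-1) t).eval (x (j-1)) with huin
  have hce : ∀ j ∈ Finset.Icc 1 N, ∀ t ∈ Set.Icc (0:ℝ) T, ∃ D : ℝ,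
      HasDerivAt (fun s => ∫ y in (x (j-1))..(x j), (E j s).eval y ^ 2) D t ∧
      D ≤ (uin j t - u0 (x (j-1) - t)) ^ 2 - (E j t).eval (x j) ^ 2
        + 2 * (((x j - x (j-1)) / 2) ^ 2 * Gfun k (x (j-1)) (x j) u0 3 t
          * ∫ y in (x (j-1))..(x j), (F j 2).eval y * (E j t).eval y) := fun j hj t ht =>
    cell_energy k hk (mf j hj).1 u0 hu (P j) (hP j hj) (F j) (hF j hj) (uh j) (hDG.1 j hj) (hDG.2.1 j hj) t
      (uin j t) (fun v hv => hDG.2.2 j hj t ht v hv)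
  have hce' : ∀ j : ℕ, ∀ t : ℝ, ∃ D : ℝ, j ∈ Finset.Icc 1 N → t ∈ Set.Icc (0:ℝ) T →
      HasDerivAt (fun s => ∫ y in (x (j-1))..(x j), (E j s).eval y ^ 2) D t ∧
      D ≤ (uin j t - u0 (x (j-1) - t)) ^ 2 - (E j t).eval (x j) ^ 2
        + 2 * (((x j - x (j-1)) / 2) ^ 2 * Gfun k (x (j-1)) (x j) u0 3 t
          * ∫ y in (x (j-1))..(x j), (F j 2).eval y * (E j t).eval y) := by
    intro j t
    by_cases hj : j ∈ Finset.Icc 1 N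
    · by_cases ht : t ∈ Set.Icc (0:ℝ) T
      · obtain ⟨D, hD⟩ := hce j hj t ht
        exact ⟨D, fun _ _ => hD⟩
      · exact ⟨0, fun _ h => absurd h ht⟩
    · exact ⟨0, fun h => absurd h hj⟩
  choose D hD using hce'
  set I : ℕ → ℝ → ℝ := fun j t => ∫ y in (x (j-1))..(x j), (E j t).eval y ^ 2 with hI
  have hI0 : ∀ j ∈ Finset.Icc 1 N, ∀ t, 0 ≤ I j t := fun j hj t =>
    intervalIntegral.integral_nonneg (mf j hj).1.le fun _ _ => sq_nonneg _
  have hS0 : ∀ t, 0 ≤ ∑ j ∈ Finset.Icc 1 N, I j t := fun t => Finset.sum_nonneg fun j hj => hI0 j hj t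
  set B := KG * KF * M * h ^ (k + 3) with hB
  have hB0 : 0 ≤ B := by positivity
  have main := sqrt_gronwall (fun t => ∑ j ∈ Finset.Icc 1 N, I j t) (fun t => ∑ j ∈ Finset.Icc 1 N, D j t) T
    (B * Real.sqrt (2 * Real.pi)) (fun t ht => HasDerivAt.fun_sum fun j hj => (hD j t hj ht).1) hS0
    (by positivity) ?_
  · intro t ht
    refine (main t ht).trans (le_of_eq ?_)
    simp only [hI, hE, hB]
    ring
  intro t ht
  -- flux part
  have hfl : ∑ j ∈ Finset.Icc 1 N, ((uin j t - u0 (x (j-1) - t)) ^ 2 - (E j t).eval (x j) ^ 2) ≤ 0 := by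
    have hEr : ∀ j ∈ Finset.Icc 1 N, (E j t).eval (x j) = (uh j t).eval (x j) - u0 (x j - t) := fun j hj =>
      errP_right k hk (mf j hj).1 u0 (P j) (hP j hj) (F j) (hF j hj) (uh j) t
    refine flux_sum N hN (fun j => (E j t).eval (x j)) (fun j => uin j t - u0 (x (j-1) - t)) ?_ ?_
    · intro j h2 hjN
      have a1 : j ≠ 1 := by omega
      simp only [huin, a1, if_false]
      exact (hEr (j-1) (Finset.mem_Icc.2 ⟨by omega, by omega⟩)).symm
    · have hEN := hEr N (Finset.mem_Icc.2 ⟨hN, le_rfl⟩)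
      simp only [huin, if_true, Nat.sub_self, hx0, zero_sub]
      rcases hbc with ⟨h1, h2⟩ | h1
      · right
        rw [hEN, h1, hxN, ← h2 (-t)]
        congr 2; ring
      · left; rw [h1]; ring
  -- residual part
  have hres : ∀ j ∈ Finset.Icc 1 N, ((x j - x (j-1)) / 2) ^ 2 * Gfun k (x (j-1)) (x j) u0 3 t
          * (∫ y in (x (j-1))..(x j), (F j 2).eval y * (E j t).eval y)
        ≤ B * (Real.sqrt (x j - x (j-1)) * Real.sqrt (I j t)) := by
    intro j hj
    obtain ⟨hab, ha0, hb2⟩ := mf j hj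
    have cE := (E j t).continuous
    have cF := (F j 2).continuous
    have hG := HG _ _ hab u0 hu 3 le_rfl M t (fun y hy => hM _ (by omega) _
      ⟨by have := ht.2; have := hy.1; linarith, by have := ht.1; have := hy.2; linarith⟩)
    have hFE : |∫ y in (x (j-1))..(x j), (F j 2).eval y * (E j t).eval y|
        ≤ KF * ∫ y in (x (j-1))..(x j), |(E j t).eval y| := by
      refine (intervalIntegral.abs_integral_le_integral_abs hab.le).trans ?_
      rw [← intervalIntegral.integral_const_mul]
      refine intervalIntegral.integral_mono_on hab.le (Continuous.intervalIntegrable (by fun_prop) _ _)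
        (Continuous.intervalIntegrable (by fun_prop) _ _) fun y hy => ?_
      rw [abs_mul]
      exact mul_le_mul_of_nonneg_right (HF _ _ hab (F j) (hF j hj) y hy).2.1 (abs_nonneg _)
    have hcs := cs_abs hab (fun y => (E j t).eval y) cE
    have hd0 : 0 ≤ x j - x (j-1) := by linarith
    have hdh := hh j hj
    refine (le_abs_self _).trans ?_
    rw [abs_mul, abs_mul]
    calc _ ≤ h ^ 2 * (KG * (M * h ^ (k+1))) * (KF * (Real.sqrt (x j - x (j-1)) * Real.sqrt (I j t))) := by
          refine mul_le_mul (mul_le_mul ?_ ?_ (abs_nonneg _) (by positivity)) ?_ (abs_nonneg _) (by positivity)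
          · rw [abs_of_nonneg (by positivity)]
            exact pow_le_pow_left₀ (by positivity) (by linarith) 2
          · refine hG.trans ?_
            gcongr
          · exact hFE.trans (mul_le_mul_of_nonneg_left hcs hKF.le)
      _ = _ := by rw [hB]; ring
  have hcs2 : ∑ j ∈ Finset.Icc 1 N, (Real.sqrt (x j - x (j-1)) * Real.sqrt (I j t))
      ≤ Real.sqrt (2 * Real.pi) * Real.sqrt (∑ j ∈ Finset.Icc 1 N, I j t) := by
    have h1 := Real.sum_sqrt_mul_sqrt_le (Finset.Icc 1 N) (f := fun j => max 0 (x j - x (j-1)))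
      (g := fun j => max 0 (I j t)) (fun _ => le_max_left _ _) (fun _ => le_max_left _ _)
    have e1 : ∀ j ∈ Finset.Icc 1 N, max 0 (x j - x (j-1)) = x j - x (j-1) := fun j hj =>
      max_eq_right (by linarith [(mf j hj).1])
    have e2 : ∀ j ∈ Finset.Icc 1 N, max 0 (I j t) = I j t := fun j hj => max_eq_right (hI0 j hj t)
    rw [Finset.sum_congr rfl e1, Finset.sum_congr rfl e2, tele_Icc, hx0, hxN, sub_zero] at h1
    refine le_trans (le_of_eq (Finset.sum_congr rfl fun j hj => ?_)) h1
    rw [e1 j hj, e2 j hj]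
  have hsum : ∑ j ∈ Finset.Icc 1 N, D j t ≤ ∑ j ∈ Finset.Icc 1 N,
      (((uin j t - u0 (x (j-1) - t)) ^ 2 - (E j t).eval (x j) ^ 2)
        + 2 * (B * (Real.sqrt (x j - x (j-1)) * Real.sqrt (I j t)))) := by
    refine Finset.sum_le_sum fun j hj => ?_
    have := (hD j t hj ht).2
    have := hres j hj
    linarith
  rw [Finset.sum_add_distrib, ← Finset.mul_sum, ← Finset.mul_sum] at hsum
  have := mul_le_mul_of_nonneg_left hcs2 hB0
  change ∑ j ∈ Finset.Icc 1 N, D j t ≤ 2 * (B * Real.sqrt (2 * Real.pi)) * Real.sqrt (∑ j ∈ Finset.Icc 1 N, I j t)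
  linarith

/-- derivative superconvergence of the DG solution at the interior left
Radau points, `|∂ₓu(r,t) - ∂ₓu_h(r,t)| ≤ C (1+t) h^{k+1} M_{k+4}`, given the initial error
`‖u_h(·,0) - u_I^2(·,0)‖₀ ≤ C₀ h^{k+3} M_{k+4}`. -/
theorem stmt17 (k : ℕ) (hk : 2 ≤ k) (c : ℝ) (hc : 1 ≤ c) (C₀ : ℝ) :
    ∃ C : ℝ, 0 < C ∧
      ∀ (N : ℕ) (x : ℕ → ℝ) (h T : ℝ), 1 ≤ N → x 0 = 0 → x N = 2 * Real.pi →
        (∀ j < N, x j < x (j+1)) →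
        (∀ j ∈ Finset.Icc 1 N, x j - x (j-1) ≤ h) →
        (∀ j ∈ Finset.Icc 1 N, h ≤ c * (x j - x (j-1))) →
        0 < T →
        ∀ u0 : ℝ → ℝ, ContDiff ℝ (k+4) u0 →
        ∀ M : ℝ,
          (∀ i ≤ k+4, ∀ y ∈ Set.Icc (-T) (2 * Real.pi), |iteratedDeriv i u0 y| ≤ M) →
        ∀ P : ℕ → ℝ → Polynomial ℝ,
          (∀ j ∈ Finset.Icc 1 N, ∀ t : ℝ,
            IsGRProj k (x (j-1)) (x j) (fun y => u0 (y - t)) (P j t)) →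
        ∀ F : ℕ → ℕ → Polynomial ℝ,
          (∀ j ∈ Finset.Icc 1 N, IsFSeq k (x (j-1)) (x j) (F j)) →
        ∀ (inflow : ℝ → ℝ) (uh : ℕ → ℝ → Polynomial ℝ),
          IsDGSol k N x T inflow uh →
          (((∀ t, inflow t = (uh N t).eval (x N))
              ∧ (∀ y : ℝ, u0 (y + 2 * Real.pi) = u0 y))
            ∨ (∀ t, inflow t = u0 (-t))) →
          Real.sqrt (∑ j ∈ Finset.Icc 1 N, ∫ y in (x (j-1))..(x j),
              ((uh j 0).eval y - uIl k (x (j-1)) (x j) u0 (P j) (F j) 2 y 0)^2)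
            ≤ C₀ * h^(k+3) * M →
        ∀ j ∈ Finset.Icc 1 N, ∀ t ∈ Set.Icc (0:ℝ) T,
        ∀ r ∈ Set.Ioo (x (j-1)) (x j),
          legendreCell (k+1) (x (j-1)) (x j) r + legendreCell k (x (j-1)) (x j) r = 0 →
          |deriv u0 (r - t) - (uh j t).derivative.eval r|
            ≤ C * (1 + t) * h^(k+1) * M := by
  obtain ⟨KL, hKL, HL⟩ := l2_bound k hk
  obtain ⟨KI, hKI, HI⟩ := inv_ineq k
  obtain ⟨KR, hKR, HR⟩ := radau_deriv k (by omega)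
  obtain ⟨KG, hKG, HG⟩ := Gfun_bound k
  obtain ⟨KF, hKF, HF⟩ := F_bound k
  have hpi := Real.pi_pos
  have hc0 : 0 < c := by linarith
  set KE := KI * c ^ 2 * Real.sqrt (2 * Real.pi * c) * (|C₀| + KL) with hKE
  have hKE0 : 0 ≤ KE := by positivity
  refine ⟨KE + KR + KG * KF + KG * KF * (2 * Real.pi * c), by positivity, ?_⟩
  intro N x h T hN hx0 hxN hx hh hhc hT u0 hu' M hM P hP F hF inflow uh hDG hbc hinit j hj t ht r hr hrad
  have hu : ContDiff ℝ (k + 4 : ℕ) u0 := by exact_mod_cast hu'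
  have mf := mesh_facts N x hx0 hxN hx
  obtain ⟨hab, ha0, hb2⟩ := mf j hj
  have hM0 : 0 ≤ M := (abs_nonneg _).trans (hM 0 (by omega) 0 ⟨by linarith, by positivity⟩)
  have hdh := hh j hj
  have hhd := hhc j hj
  have hpos : 0 < h := by linarith
  have hL := HL N x h T hN hx0 hxN hx hh hpos hT u0 hu M hM0 hM P hP F hF inflow uh hDG hbc t ht
  have hyt : ∀ y ∈ Set.Icc (x (j-1)) (x j), y - t ∈ Set.Icc (-T) (2 * Real.pi) := fun y hy =>
    ⟨by have := ht.2; have := hy.1; linarith, by have := ht.1; have := hy.2; linarith⟩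
  have ht0 := ht.1
  have hrI : r ∈ Set.Icc (x (j-1)) (x j) := Set.Ioo_subset_Icc_self hr
  set a := x (j-1) with ha
  set b := x j with hb
  set d := b - a with hd
  have hd0 : 0 < d := by linarith
  have hd2 : d ≤ 2 * Real.pi := by linarith
  have hh2 : h ≤ 2 * Real.pi * c := by nlinarith
  set E := errP k a b u0 (P j) (F j) (uh j) t with hE
  -- the L2 bound of the error
  have hS : Real.sqrt (∫ y in a..b, E.eval y ^ 2) ≤ (|C₀| + KL) * (1 + t) * h ^ (k + 3) * M := by
    have h1 : (∫ y in a..b, E.eval y ^ 2) ≤ ∑ j ∈ Finset.Icc 1 N, ∫ y in (x (j-1))..(x j),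
              (errP k (x (j-1)) (x j) u0 (P j) (F j) (uh j) t).eval y ^ 2 :=
      Finset.single_le_sum (f := fun j => ∫ y in (x (j-1))..(x j),
              (errP k (x (j-1)) (x j) u0 (P j) (F j) (uh j) t).eval y ^ 2) (fun i hi =>
        intervalIntegral.integral_nonneg (mf i hi).1.le fun _ _ => sq_nonneg _) hj
    have h2 := Real.sqrt_le_sqrt h1
    simp only [errP_eval _ _ _ _ _ _ _ 0] at hL
    have h3 : C₀ * h ^ (k+3) * M ≤ |C₀| * h ^ (k+3) * M := by
      gcongr; exact le_abs_self _
    have h4 : (|C₀| + KL) * (1 + t) * h ^ (k + 3) * M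
      = |C₀| * h ^ (k+3) * M + KL * h ^ (k+3) * M * t + (|C₀| * t + KL) * h ^ (k+3) * M := by ring
    have h5 : 0 ≤ (|C₀| * t + KL) * h ^ (k+3) * M := by positivity
    linarith
  have hEr : |E.derivative.eval r| ≤ KE * (1 + t) * h ^ (k+1) * M := by
    have h1 := HI a b hab E (errP_natDegree k hk hab u0 (P j) (hP j hj) (F j) (hF j hj) (uh j) (hDG.1 j hj) t)
      r hrI
    have h2 := cs_abs hab (fun y => E.eval y) E.continuous
    have h3 : Real.sqrt d ≤ Real.sqrt (2 * Real.pi * c) := Real.sqrt_le_sqrt (by nlinarith)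
    have h4 : KI / d ^ 2 ≤ KI * c ^ 2 / h ^ 2 := by
      rw [div_le_div_iff₀ (by positivity) (by positivity), mul_assoc, ← mul_pow]
      exact mul_le_mul_of_nonneg_left (pow_le_pow_left₀ hpos.le hhd 2) hKI.le
    calc |E.derivative.eval r| ≤ KI / d ^ 2 * ∫ y in a..b, |E.eval y| := h1
      _ ≤ (KI * c ^ 2 / h ^ 2) * (Real.sqrt (2 * Real.pi * c) * ((|C₀| + KL) * (1 + t) * h ^ (k + 3) * M)) := by
        refine mul_le_mul h4 (h2.trans (mul_le_mul h3 hS (Real.sqrt_nonneg _) (Real.sqrt_nonneg _)))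
          (intervalIntegral.integral_nonneg hab.le fun _ _ => abs_nonneg _) (by positivity)
      _ = _ := by
        rw [hKE]
        have : h ^ (k + 3) = h ^ 2 * h ^ (k+1) := by ring
        rw [this]
        field_simp
  have hRr : |deriv u0 (r - t) - (P j t).derivative.eval r| ≤ KR * (M * h ^ (k+1)) := by
    have hf : ContDiff ℝ (k + 2) (fun y => u0 (y - t)) := by
      have : ContDiff ℝ (k + 2 : ℕ) u0 := hu.of_le (by exact_mod_cast (by omega))
      have h2 : ContDiff ℝ (k + 2) u0 := by exact_mod_cast this
      exact h2.comp (contDiff_id.sub contDiff_const)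
    have h1 := HR a b hab (fun y => u0 (y - t)) hf M (fun y hy => by
      rw [iteratedDeriv_comp_sub_const]
      exact hM _ (by omega) _ (hyt y hy)) (P j t) (hP j hj t) r hr (by
        rw [legendreCell_eq, legendreCell_eq] at hrad
        exact hrad)
    rw [deriv_comp_sub_const] at h1
    refine h1.trans ?_
    gcongr
  have hGi : ∀ i ≤ 3, |Gfun k a b u0 i t| ≤ KG * (M * h ^ (k+1)) := fun i hi => by
    refine (HG a b hab u0 hu i hi M t fun y hy => hM _ (by omega) _ (hyt y hy)).trans ?_
    gcongr
  obtain ⟨f1, -, f2⟩ := HF a b hab (F j) (hF j hj) r hrI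
  have hW1 : |d / 2 * Gfun k a b u0 1 t * (F j 1).derivative.eval r| ≤ KG * KF * h ^ (k+1) * M := by
    rw [abs_mul, abs_mul, abs_of_pos (by positivity : 0 < d / 2)]
    calc _ ≤ d * (KG * (M * h ^ (k+1))) * (KF / d) := by
          refine mul_le_mul (mul_le_mul (by linarith) (hGi 1 (by omega)) (abs_nonneg _) hd0.le) f1
            (abs_nonneg _) (by positivity)
      _ = _ := by field_simp
  have hW2 : |(d / 2) ^ 2 * Gfun k a b u0 2 t * (F j 2).derivative.eval r|
      ≤ KG * KF * (2 * Real.pi * c) * h ^ (k+1) * M := by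
    rw [abs_mul, abs_mul, abs_of_pos (by positivity : 0 < (d / 2) ^ 2)]
    calc _ ≤ (d * (2 * Real.pi * c)) * (KG * (M * h ^ (k+1))) * (KF / d) := by
          refine mul_le_mul (mul_le_mul (by nlinarith) (hGi 2 (by omega)) (abs_nonneg _) (by positivity)) f2
            (abs_nonneg _) (by positivity)
      _ = _ := by field_simp
  have hsplit : deriv u0 (r - t) - (uh j t).derivative.eval r
      = (deriv u0 (r - t) - (P j t).derivative.eval r) - E.derivative.eval r
        + d / 2 * Gfun k a b u0 1 t * (F j 1).derivative.eval r
        + (d / 2) ^ 2 * Gfun k a b u0 2 t * (F j 2).derivative.eval r := by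
    rw [hE, errP]
    simp only [Polynomial.derivative_add, Polynomial.derivative_sub, Polynomial.derivative_C_mul,
      Polynomial.eval_add, Polynomial.eval_sub, Polynomial.eval_C_mul]
    ring
  rw [hsplit]
  have q1 := abs_add_le ((deriv u0 (r - t) - (P j t).derivative.eval r) - E.derivative.eval r
        + d / 2 * Gfun k a b u0 1 t * (F j 1).derivative.eval r)
        ((d / 2) ^ 2 * Gfun k a b u0 2 t * (F j 2).derivative.eval r)
  have q2 := abs_add_le ((deriv u0 (r - t) - (P j t).derivative.eval r) - E.derivative.eval r)
        (d / 2 * Gfun k a b u0 1 t * (F j 1).derivative.eval r)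
  have q3 := abs_sub (deriv u0 (r - t) - (P j t).derivative.eval r) (E.derivative.eval r)
  have q4 : (KE + KR + KG * KF + KG * KF * (2 * Real.pi * c)) * (1 + t) * h ^ (k+1) * M
      = KE * (1 + t) * h ^ (k+1) * M + KR * (M * h ^ (k+1)) + KG * KF * h ^ (k+1) * M
        + KG * KF * (2 * Real.pi * c) * h ^ (k+1) * M
        + (KR + KG * KF + KG * KF * (2 * Real.pi * c)) * t * h ^ (k+1) * M := by ring
  have q5 : 0 ≤ (KR + KG * KF + KG * KF * (2 * Real.pi * c)) * t * h ^ (k+1) * M := by positivity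
  linarith
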